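/- Let (u, b, p) be a smooth bounded solution of the stationary MHD/Hall–MHD system with parameter δ ∈ [0,1] on the slab ℝ²×𝕋, and suppose there exist constants C > 0 and α > 0 such that ∫_{{|x'| ≤ R}×[0,1]} (|∇u|² + |∇b|²) dx ≤ C R^α for all R > 1. If the swirl components u^θ and b^θ are axisymmetric, then there are constants c₁, c₂ ∈ ℝ with u ≡ (0, 0, c₁) and b ≡ (0, 0, c₂). -/

import Mathlib

open MeasureTheory

noncomputable section

/-- Points of `ℝ³`. -/
abbrev V3 : Type := Fin 3 → ℝ

/-- Partial derivative `∂ᵢ f`. -/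
def pd (i : Fin 3) (f : V3 → ℝ) (x : V3) : ℝ := fderiv ℝ f x (Pi.single i 1)

/-- Componentwise Laplacian. -/
def lap (f : V3 → ℝ) (x : V3) : ℝ := ∑ i, pd i (pd i f) x

/-- Cross product in `ℝ³`. -/
def cross3 (a c : V3) : V3 :=
  ![a 1 * c 2 - a 2 * c 1, a 2 * c 0 - a 0 * c 2, a 0 * c 1 - a 1 * c 0]

/-- Curl of a vector field. -/
def curl (b : V3 → V3) (x : V3) : V3 :=
  ![pd 1 (fun y => b y 2) x - pd 2 (fun y => b y 1) x,
    pd 2 (fun y => b y 0) x - pd 0 (fun y => b y 2) x,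
    pd 0 (fun y => b y 1) x - pd 1 (fun y => b y 0) x]

/-- Euclidean dot product in `ℝ³`. -/
def dot3 (a c : V3) : ℝ := ∑ i, a i * c i

/-- `|x'| = √(x₁² + x₂²)`. -/
def nr (x : V3) : ℝ := Real.sqrt ((x 0) ^ 2 + (x 1) ^ 2)

/-- The slab `ℝ² × [0,1]`. -/
def slab : Set V3 := {x | 0 ≤ x 2 ∧ x 2 ≤ 1}

/-- The region `{|x'| ≤ R} × [0,1]`. -/
def cylSet (R : ℝ) : Set V3 := {x | (0 ≤ x 2 ∧ x 2 ≤ 1) ∧ nr x ≤ R}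

/-- The annular region `O_R = {R-1 ≤ |x'| ≤ R} × [0,1]`. -/
def OR (R : ℝ) : Set V3 := {x | (0 ≤ x 2 ∧ x 2 ≤ 1) ∧ R - 1 ≤ nr x ∧ nr x ≤ R}

/-- The radial cut-off function `φ_R`. -/
def phiR (R : ℝ) (x : V3) : ℝ := min 1 (max 0 (R - nr x))

/-- `|∇u|² = Σ_{i,j} |∂ᵢ uʲ|²`. -/
def gradSq (u : V3 → V3) (x : V3) : ℝ := ∑ i, ∑ j, (pd i (fun y => u y j) x) ^ 2

/-- The `L²` norm of a scalar function on a set. -/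
def l2 (f : V3 → ℝ) (S : Set V3) : ℝ := Real.sqrt (∫ x in S, (f x) ^ 2)

/-- The radial component `u^r` as a function of `x`. -/
def ur (u : V3 → V3) (x : V3) : ℝ := (x 0 * u x 0 + x 1 * u x 1) / nr x

/-- The point with cylindrical coordinates `(r, θ, z)`. -/
def cylPt (r θ z : ℝ) : V3 := ![r * Real.cos θ, r * Real.sin θ, z]

/-- The radial component `u^r` in cylindrical coordinates. -/
def compR (u : V3 → V3) (r θ z : ℝ) : ℝ :=
  Real.cos θ * u (cylPt r θ z) 0 + Real.sin θ * u (cylPt r θ z) 1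

/-- The swirl component `u^θ` in cylindrical coordinates. -/
def compTheta (u : V3 → V3) (r θ z : ℝ) : ℝ :=
  -Real.sin θ * u (cylPt r θ z) 0 + Real.cos θ * u (cylPt r θ z) 1

/-- A cylindrical component is axisymmetric if it is independent of `θ`. -/
def AxiSym (f : ℝ → ℝ → ℝ → ℝ) : Prop := ∀ r θ₁ θ₂ z, f r θ₁ z = f r θ₂ z

/-- `1`-periodicity in the `x₃` variable. -/
def PeriodicZ (u : V3 → V3) : Prop := ∀ x : V3, u ![x 0, x 1, x 2 + 1] = u x

/-- Divergence-free vector field. -/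
def DivFree (u : V3 → V3) : Prop := ∀ x, ∑ i, pd i (fun y => u y i) x = 0

/-- Boundedness of a vector field. -/
def Bounded3 (u : V3 → V3) : Prop := ∃ M, ∀ x, ‖u x‖ ≤ M

/-- The stationary MHD (`δ = 0`) / Hall–MHD (`δ = 1`) system:
`(u·∇)u + ∇p − (b·∇)b − Δu = 0`,
`(u·∇)b − (b·∇)u − Δb = δ ∇×((∇×b)×b)`, `div u = div b = 0`. -/
def IsMHD (δ : ℝ) (u b : V3 → V3) (p : V3 → ℝ) : Prop :=
  (∀ x i, (∑ j, u x j * pd j (fun y => u y i) x) + pd i p x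
      - (∑ j, b x j * pd j (fun y => b y i) x) - lap (fun y => u y i) x = 0) ∧
  (∀ x i, (∑ j, u x j * pd j (fun y => b y i) x)
      - (∑ j, b x j * pd j (fun y => u y i) x) - lap (fun y => b y i) x
      = δ * curl (fun y => cross3 (curl b y) (b y)) x i) ∧
  DivFree u ∧ DivFree b

/-- Growth of the local Dirichlet integral: `∫_{{|x'|≤R}×[0,1]} |∇u|²+|∇b|² ≤ C R^α`. -/
def DirichletGrowth (u b : V3 → V3) : Prop :=
  ∃ C > (0:ℝ), ∃ α > (0:ℝ), ∀ R > (1:ℝ),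
    (∫ x in cylSet R, (gradSq u x + gradSq b x)) ≤ C * R ^ α

/-- Radial derivative `∂_r f = (x'/|x'|)·(∂₁f, ∂₂f)`. -/
def radD (f : V3 → ℝ) (x : V3) : ℝ := (x 0 / nr x) * pd 0 f x + (x 1 / nr x) * pd 1 f x

/-- The unit radial vector `(x'/|x'|, 0)`. -/
def er3 (x : V3) : V3 := ![x 0 / nr x, x 1 / nr x, 0]

/-- Squared Euclidean length of a vector of `ℝ³`. -/
def sq3 (v : V3) : ℝ := ∑ i, (v i) ^ 2

namespace SlabLiouville

/-! ### Smooth functions on the slab -/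

@[fun_prop]
theorem contDiff_pd {i : Fin 3} {f : V3 → ℝ} (hf : ContDiff ℝ (⊤ : ℕ∞) f) :
    ContDiff ℝ (⊤ : ℕ∞) (pd i f) := by
  have h : ContDiff ℝ (⊤ : ℕ∞) (fderiv ℝ f) := hf.fderiv_right (by simp)
  exact h.clm_apply contDiff_const

theorem differentiableAt_of_contDiff {f : V3 → ℝ} (hf : ContDiff ℝ (⊤ : ℕ∞) f) (x : V3) :
    DifferentiableAt ℝ f x :=
  (hf.differentiable (by simp)) x

theorem pd_add {f g : V3 → ℝ} (hf : ContDiff ℝ (⊤ : ℕ∞) f) (hg : ContDiff ℝ (⊤ : ℕ∞) g)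
    (i : Fin 3) (x : V3) : pd i (fun y => f y + g y) x = pd i f x + pd i g x := by
  simp only [pd]
  rw [fderiv_fun_add (differentiableAt_of_contDiff hf x) (differentiableAt_of_contDiff hg x)]
  rfl

theorem pd_sub {f g : V3 → ℝ} (hf : ContDiff ℝ (⊤ : ℕ∞) f) (hg : ContDiff ℝ (⊤ : ℕ∞) g)
    (i : Fin 3) (x : V3) : pd i (fun y => f y - g y) x = pd i f x - pd i g x := by
  simp only [pd]
  rw [fderiv_fun_sub (differentiableAt_of_contDiff hf x) (differentiableAt_of_contDiff hg x)]
  rfl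

theorem pd_mul {f g : V3 → ℝ} (hf : ContDiff ℝ (⊤ : ℕ∞) f) (hg : ContDiff ℝ (⊤ : ℕ∞) g)
    (i : Fin 3) (x : V3) :
    pd i (fun y => f y * g y) x = f x * pd i g x + pd i f x * g x := by
  simp only [pd]
  rw [fderiv_fun_mul (differentiableAt_of_contDiff hf x) (differentiableAt_of_contDiff hg x)]
  simp [mul_comm]

theorem pd_const (c : ℝ) (i : Fin 3) (x : V3) : pd i (fun _ => c) x = 0 := by
  simp [pd]

theorem pd_coord (i j : Fin 3) (x : V3) :
    pd i (fun y => y j) x = if j = i then 1 else 0 := by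
  have : HasFDerivAt (fun y : V3 => y j)
      (ContinuousLinearMap.proj (R := ℝ) (φ := fun _ => ℝ) j) x :=
    (ContinuousLinearMap.proj (R := ℝ) (φ := fun _ => ℝ) j).hasFDerivAt
  simp [pd, this.fderiv, Pi.single_apply]

theorem pd_comm {f : V3 → ℝ} (hf : ContDiff ℝ (⊤ : ℕ∞) f) (i j : Fin 3) (x : V3) :
    pd i (pd j f) x = pd j (pd i f) x := by
  have h : ContDiff ℝ (⊤ : ℕ∞) (fderiv ℝ f) := hf.fderiv_right (by simp)
  have hd : DifferentiableAt ℝ (fderiv ℝ f) x := h.differentiable (by simp) x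
  have key : ∀ i j, pd i (pd j f) x = fderiv ℝ (fderiv ℝ f) x (Pi.single i 1) (Pi.single j 1) := by
    intro i j
    have : pd j f = fun y => (fderiv ℝ f y) (Pi.single j 1) := rfl
    rw [this]
    simp only [pd]
    rw [fderiv_clm_apply hd (by fun_prop)]
    simp
  rw [key, key]
  exact (hf.contDiffAt.isSymmSndFDerivAt (by
    simp only [minSmoothness_of_isRCLikeNormedField]
    exact WithTop.coe_le_coe.2 le_top)) _ _

/-- Invariance under the unit translation in `x₃`. -/
def ZPer (f : V3 → ℝ) : Prop := ∀ x, f (x + Pi.single 2 1) = f x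

/-- Vanishing outside a cylinder. -/
def CylSupp (f : V3 → ℝ) : Prop := ∃ L : ℝ, ∀ x : V3, L ≤ x 0 ^ 2 + x 1 ^ 2 → f x = 0

theorem ZPer.pd {f : V3 → ℝ} (hf : ZPer f) (i : Fin 3) : ZPer (pd i f) := by
  intro x
  have h : (fun y => f (y + Pi.single 2 1)) = f := funext hf
  have := fderiv_comp_add_right (𝕜 := ℝ) (f := f) (x := x) (Pi.single 2 1 : V3)
  simp only [h] at this
  simp only [_root_.pd, this]

theorem CylSupp.pd {f : V3 → ℝ} (hf : CylSupp f) (i : Fin 3) : CylSupp (pd i f) := by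
  obtain ⟨L, hL⟩ := hf
  refine ⟨L + 1, fun x hx => ?_⟩
  have ho : IsOpen {y : V3 | L < y 0 ^ 2 + y 1 ^ 2} :=
    isOpen_lt continuous_const (by fun_prop)
  have : f =ᶠ[nhds x] fun _ => 0 := by
    filter_upwards [ho.mem_nhds (show L < x 0 ^ 2 + x 1 ^ 2 by linarith)] with y hy
    exact hL y (le_of_lt hy)
  simp [_root_.pd, this.fderiv_eq]

/-- Smooth functions on the slab `ℝ² × 𝕋`. -/
structure Adm (f : V3 → ℝ) : Prop where
  smooth : ContDiff ℝ (⊤ : ℕ∞) f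
  per : ZPer f

/-- Smooth functions on the slab `ℝ² × 𝕋` with compact support. -/
structure Tst (f : V3 → ℝ) : Prop extends Adm f where
  supp : CylSupp f

theorem Adm.pd {f : V3 → ℝ} (hf : Adm f) (i : Fin 3) : Adm (pd i f) :=
  ⟨contDiff_pd hf.smooth, hf.per.pd i⟩

theorem Tst.pd {f : V3 → ℝ} (hf : Tst f) (i : Fin 3) : Tst (pd i f) :=
  ⟨hf.toAdm.pd i, hf.supp.pd i⟩

theorem Adm.const (c : ℝ) : Adm (fun _ => c) := ⟨contDiff_const, fun _ => rfl⟩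

theorem Adm.add {f g : V3 → ℝ} (hf : Adm f) (hg : Adm g) : Adm (fun x => f x + g x) :=
  ⟨hf.smooth.add hg.smooth, fun x => by simp only [hf.per x, hg.per x]⟩

theorem Adm.sub {f g : V3 → ℝ} (hf : Adm f) (hg : Adm g) : Adm (fun x => f x - g x) :=
  ⟨hf.smooth.sub hg.smooth, fun x => by simp only [hf.per x, hg.per x]⟩

theorem Adm.mul {f g : V3 → ℝ} (hf : Adm f) (hg : Adm g) : Adm (fun x => f x * g x) :=
  ⟨hf.smooth.mul hg.smooth, fun x => by simp only [hf.per x, hg.per x]⟩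

theorem Adm.sum {f : Fin 3 → V3 → ℝ} (hf : ∀ i, Adm (f i)) : Adm (fun x => ∑ i, f i x) :=
  ⟨ContDiff.sum fun i _ => (hf i).smooth, fun x => Finset.sum_congr rfl fun i _ => (hf i).per x⟩

theorem Adm.coord {j : Fin 3} (hj : j ≠ 2) : Adm (fun x => x j) :=
  ⟨by fun_prop, fun x => by simp [hj]⟩

theorem CylSupp.add {f g : V3 → ℝ} (hf : CylSupp f) (hg : CylSupp g) :
    CylSupp (fun x => f x + g x) := by
  obtain ⟨L, hL⟩ := hf
  obtain ⟨L', hL'⟩ := hg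
  refine ⟨max L L', fun x hx => ?_⟩
  simp only [hL x ((le_max_left _ _).trans hx), hL' x ((le_max_right _ _).trans hx), add_zero]

theorem Tst.add {f g : V3 → ℝ} (hf : Tst f) (hg : Tst g) : Tst (fun x => f x + g x) :=
  ⟨hf.toAdm.add hg.toAdm, hf.supp.add hg.supp⟩

theorem Tst.mul_left {f g : V3 → ℝ} (hf : Adm f) (hg : Tst g) : Tst (fun x => f x * g x) :=
  ⟨hf.mul hg.toAdm, let ⟨L, hL⟩ := hg.supp; ⟨L, fun x hx => by simp only [hL x hx, mul_zero]⟩⟩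

theorem Tst.mul_right {f g : V3 → ℝ} (hf : Tst f) (hg : Adm g) : Tst (fun x => f x * g x) :=
  ⟨hf.toAdm.mul hg, let ⟨L, hL⟩ := hf.supp; ⟨L, fun x hx => by simp only [hL x hx, zero_mul]⟩⟩

theorem Tst.sub {f g : V3 → ℝ} (hf : Tst f) (hg : Tst g) : Tst (fun x => f x - g x) := by
  have := hf.add (Tst.mul_left (Adm.const (-1)) hg)
  simpa [sub_eq_add_neg] using this

/-! ### Integration over the slab -/

theorem measurableSet_slab : MeasurableSet slab :=
  (isClosed_le continuous_const (continuous_apply 2)).measurableSet.inter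
    (isClosed_le (continuous_apply 2) continuous_const).measurableSet

/-- The box `[-L, L]² × [0, 1]`. -/
def box (L : ℝ) : Set V3 := Set.Icc ![-L, -L, 0] ![L, L, 1]

theorem mem_box {L : ℝ} {x : V3} :
    x ∈ box L ↔ (|x 0| ≤ L ∧ |x 1| ≤ L) ∧ 0 ≤ x 2 ∧ x 2 ≤ 1 := by
  simp only [box, Set.mem_Icc, Pi.le_def, Fin.forall_fin_succ, abs_le]
  simp
  tauto

theorem volume_box {L : ℝ} (hL : 0 ≤ L) : volume (box L) = ENNReal.ofReal (4 * L ^ 2) := by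
  rw [box, Real.volume_Icc_pi, Fin.prod_univ_three]
  simp only [Matrix.cons_val, sub_neg_eq_add, sub_zero, ENNReal.ofReal_one, mul_one]
  rw [← ENNReal.ofReal_mul (by linarith)]
  congr 1; ring

theorem box_subset_slab (L : ℝ) : box L ⊆ slab := fun _ hx => (mem_box.1 hx).2

theorem measurableSet_box (L : ℝ) : MeasurableSet (box L) := measurableSet_Icc

theorem isCompact_box (L : ℝ) : IsCompact (box L) := isCompact_Icc

theorem eq_zero_of_notMem_box {f : V3 → ℝ} {L : ℝ} (hL : 0 ≤ L)
    (hf : ∀ x : V3, L ^ 2 ≤ x 0 ^ 2 + x 1 ^ 2 → f x = 0) {x : V3} (hx : x ∈ slab)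
    (hxb : x ∉ box L) : f x = 0 := by
  apply hf
  rw [mem_box] at hxb
  have : L < |x 0| ∨ L < |x 1| := by
    by_contra! h
    exact hxb ⟨h, hx⟩
  rcases this with h | h
  · nlinarith [sq_abs (x 0), sq_nonneg (x 1), abs_nonneg (x 0)]
  · nlinarith [sq_abs (x 1), sq_nonneg (x 0), abs_nonneg (x 1)]

theorem CylSupp.exists_sq {f : V3 → ℝ} (hf : CylSupp f) :
    ∃ L : ℝ, 0 ≤ L ∧ ∀ x : V3, L ^ 2 ≤ x 0 ^ 2 + x 1 ^ 2 → f x = 0 := by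
  obtain ⟨L, hL⟩ := hf
  refine ⟨max L 1, by positivity, fun x hx => hL x ?_⟩
  nlinarith [le_max_left L 1, le_max_right L 1]

theorem setIntegral_slab_eq_box {f : V3 → ℝ} {L : ℝ} (hL : 0 ≤ L)
    (hf : ∀ x : V3, L ^ 2 ≤ x 0 ^ 2 + x 1 ^ 2 → f x = 0) :
    ∫ x in slab, f x = ∫ x in box L, f x :=
  setIntegral_eq_of_subset_of_forall_sdiff_eq_zero measurableSet_slab (box_subset_slab L)
    fun _ hx => eq_zero_of_notMem_box hL hf hx.1 hx.2

theorem CylSupp.integrableOn {f : V3 → ℝ} (hf : CylSupp f) (hc : Continuous f) :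
    IntegrableOn f slab := by
  obtain ⟨L, hL, hz⟩ := hf.exists_sq
  have hb : IntegrableOn f (box L) := hc.continuousOn.integrableOn_compact (isCompact_box L)
  exact hb.of_forall_sdiff_eq_zero measurableSet_slab
    fun _ hx => eq_zero_of_notMem_box hL hz hx.1 hx.2

theorem Tst.integrableOn {f : V3 → ℝ} (hf : Tst f) : IntegrableOn f slab :=
  hf.supp.integrableOn hf.smooth.continuous

theorem setIntegral_slab_pd_eq_zero {h : V3 → ℝ} (hs : ContDiff ℝ (⊤ : ℕ∞) h) (hc : CylSupp h)
    (hz : ∀ x : V3, x 2 = 0 → h (x + Pi.single 2 1) = h x) (i : Fin 3) :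
    ∫ x in slab, pd i h x = 0 := by
  obtain ⟨L, hL0, hL⟩ := hc.exists_sq
  obtain ⟨L', hL0', hL'⟩ := (hc.pd i).exists_sq
  set N := max L L' with hN
  have hNL : L ^ 2 ≤ N ^ 2 := by gcongr; exact le_max_left _ _
  have hNL' : L' ^ 2 ≤ N ^ 2 := by gcongr; exact le_max_right _ _
  have hN0 : 0 ≤ N := hL0.trans (le_max_left _ _)
  rw [setIntegral_slab_eq_box hN0 (f := pd i h) fun x hx => hL' x (hNL'.trans hx), box]
  have hint : IntegrableOn (pd i h) (Set.Icc ![-N, -N, 0] ![N, N, 1]) :=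
    (contDiff_pd hs).continuous.continuousOn.integrableOn_compact isCompact_Icc
  have key := integral_divergence_of_hasFDerivAt_off_countable' (E := ℝ)
    (![-N, -N, 0] : Fin 3 → ℝ) ![N, N, 1]
    (by intro j; fin_cases j <;> simp <;> linarith)
    (fun j => if j = i then h else 0) (fun j x => if j = i then fderiv ℝ h x else 0) ∅
    Set.countable_empty
    (fun j => by
      split_ifs
      · exact hs.continuous.continuousOn
      · exact continuousOn_const)
    (fun x _ j => by
      split_ifs
      · exact (differentiableAt_of_contDiff hs x).hasFDerivAt
      · exact hasFDerivAt_const _ _)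
  have hsum : (fun x : V3 => ∑ j, (if j = i then fderiv ℝ h x else 0) (Pi.single j 1)) =
      pd i h := by
    funext x
    rw [Finset.sum_eq_single i]
    · simp [pd]
    · intro j _ hj; simp [hj]
    · simp
  rw [hsum] at key
  rw [key hint]
  refine Finset.sum_eq_zero fun j _ => ?_
  by_cases hj : j = i
  swap
  · simp [hj]
  subst hj
  simp only [if_true]
  have hv : ∀ c : ℝ, j ≠ 2 → c ^ 2 = N ^ 2 → ∀ y : Fin 2 → ℝ,
      h (Fin.insertNth j c y : Fin 3 → ℝ) = 0 := by
    intro c hj2 hcN y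
    set v : Fin 3 → ℝ := Fin.insertNth j c y with hvdef
    have hvj : v j = c := by simp [hvdef]
    refine hL v (hNL.trans ?_)
    fin_cases j
    · have h2 : v 0 = c := by simpa using hvj
      rw [h2, hcN]
      linarith [sq_nonneg (v 1)]
    · have h2 : v 1 = c := by simpa using hvj
      rw [h2, hcN]
      linarith [sq_nonneg (v 0)]
    · simp at hj2
  by_cases hj2 : j = 2
  swap
  · simp only [hv _ hj2 (show (![N, N, 1] : Fin 3 → ℝ) j ^ 2 = N ^ 2 by
      fin_cases j <;> simp at hj2 ⊢),
      hv _ hj2 (show (![-N, -N, 0] : Fin 3 → ℝ) j ^ 2 = N ^ 2 by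
      fin_cases j <;> simp at hj2 ⊢)]
    simp
  · subst hj2
    rw [sub_eq_zero]
    refine integral_congr_ae (Filter.Eventually.of_forall fun y => ?_)
    have h0 := hz (Fin.insertNth (2 : Fin 3) 0 y : Fin 3 → ℝ) (by simp)
    have h1 : (Fin.insertNth (2 : Fin 3) (0 : ℝ) y : Fin 3 → ℝ) + Pi.single 2 1 =
        Fin.insertNth (2 : Fin 3) (1 : ℝ) y := by
      funext k
      refine Fin.succAboveCases (2 : Fin 3) ?_ (fun k => ?_) k
      · simp
      · simp [Fin.succAbove_ne]
    rw [h1] at h0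
    simpa using h0

theorem Tst.integral_pd {h : V3 → ℝ} (hh : Tst h) (i : Fin 3) : ∫ x in slab, _root_.pd i h x = 0 :=
  setIntegral_slab_pd_eq_zero hh.smooth hh.supp (fun x _ => hh.per x) i

/-! ### Integration by parts -/

/-- `(U·∇) f`. -/
def adv (U : Fin 3 → V3 → ℝ) (f : V3 → ℝ) (x : V3) : ℝ := ∑ j, U j x * pd j f x

/-- `∇f·∇g`. -/
def gdot (f g : V3 → ℝ) (x : V3) : ℝ := ∑ j, pd j f x * pd j g x

theorem Adm.adv {U : Fin 3 → V3 → ℝ} (hU : ∀ i, Adm (U i)) {f : V3 → ℝ} (hf : Adm f) :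
    Adm (adv U f) := Adm.sum fun j => (hU j).mul (hf.pd j)

theorem Adm.gdot {f g : V3 → ℝ} (hf : Adm f) (hg : Adm g) : Adm (gdot f g) :=
  Adm.sum fun j => (hf.pd j).mul (hg.pd j)

theorem Adm.lap {f : V3 → ℝ} (hf : Adm f) : Adm (lap f) :=
  Adm.sum fun j => (hf.pd j).pd j

/-- Integrable functions on the slab with vanishing integral. -/
def Null (f : V3 → ℝ) : Prop := IntegrableOn f slab ∧ ∫ x in slab, f x = 0

theorem Null.add {f g : V3 → ℝ} (hf : Null f) (hg : Null g) : Null (fun x => f x + g x) :=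
  ⟨hf.1.add hg.1, by rw [integral_add hf.1 hg.1, hf.2, hg.2, add_zero]⟩

theorem Null.sub {f g : V3 → ℝ} (hf : Null f) (hg : Null g) : Null (fun x => f x - g x) :=
  ⟨hf.1.sub hg.1, by rw [integral_sub hf.1 hg.1, hf.2, hg.2, sub_zero]⟩

theorem Null.smul {f : V3 → ℝ} (hf : Null f) (c : ℝ) : Null (fun x => c * f x) :=
  ⟨hf.1.const_mul c, by rw [integral_const_mul, hf.2, mul_zero]⟩

theorem Null.sum {f : Fin 3 → V3 → ℝ} (hf : ∀ i, Null (f i)) : Null (fun x => ∑ i, f i x) := by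
  simp only [Fin.sum_univ_three]
  exact ((hf 0).add (hf 1)).add (hf 2)

theorem Null.congr {f g : V3 → ℝ} (hf : Null f) (h : ∀ x, g x = f x) : Null g := by
  rwa [funext h]

theorem Tst.null_pd {h : V3 → ℝ} (hh : Tst h) (i : Fin 3) : Null (_root_.pd i h) :=
  ⟨(hh.pd i).integrableOn, hh.integral_pd i⟩

theorem null_mul_pd {f g : V3 → ℝ} (hf : Adm f) (hg : Tst g) (i : Fin 3) :
    Null (fun x => f x * pd i g x + pd i f x * g x) :=
  ((Tst.mul_left hf hg).null_pd i).congr fun x => (pd_mul hf.smooth hg.smooth i x).symm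

theorem null_lap {f g : V3 → ℝ} (hf : Adm f) (hg : Tst g) :
    Null (fun x => lap f x * g x + gdot f g x) := by
  refine (Null.sum fun j => null_mul_pd (hf.pd j) hg j).congr fun x => ?_
  simp only [lap, gdot, Fin.sum_univ_three]
  ring

theorem null_lap_mul {f φ : V3 → ℝ} (hf : Adm f) (hφ : Tst φ) :
    Null (fun x => φ x * (f x * lap f x) + φ x * gdot f f x + f x * gdot f φ x) := by
  refine (null_lap hf (Tst.mul_left hf hφ)).congr fun x => ?_
  simp only [gdot, pd_mul hf.smooth hφ.smooth, Fin.sum_univ_three]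
  ring

theorem null_adv {U : Fin 3 → V3 → ℝ} (hU : ∀ i, Adm (U i)) (hdiv : ∀ x, ∑ i, pd i (U i) x = 0)
    {f g : V3 → ℝ} (hf : Adm f) (hg : Tst g) :
    Null (fun x => adv U f x * g x + f x * adv U g x) := by
  have h := Null.sum fun j => (Tst.mul_left (hU j) (Tst.mul_left hf hg)).null_pd j
  refine h.congr fun x => ?_
  have hd := hdiv x
  simp only [Fin.sum_univ_three] at hd
  simp only [pd_mul (hU _).smooth (hf.mul hg.toAdm).smooth, pd_mul hf.smooth hg.smooth, adv,
    Fin.sum_univ_three]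
  linear_combination -(f x * g x) * hd

theorem null_adv_mul {U : Fin 3 → V3 → ℝ} (hU : ∀ i, Adm (U i))
    (hdiv : ∀ x, ∑ i, pd i (U i) x = 0) {f g φ : V3 → ℝ} (hf : Adm f) (hg : Adm g) (hφ : Tst φ) :
    Null (fun x => φ x * (g x * adv U f x + f x * adv U g x) + f x * g x * adv U φ x) := by
  refine (null_adv hU hdiv hf (Tst.mul_left hg hφ)).congr fun x => ?_
  simp only [pd_mul hg.smooth hφ.smooth, adv, Fin.sum_univ_three]
  ring

/-- The `i`-th component of the curl of the field with components `V`. -/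
def curlc (V : Fin 3 → V3 → ℝ) (x : V3) : V3 := curl (fun y j => V j y) x

theorem null_curl {V : Fin 3 → V3 → ℝ} {G : Fin 3 → V3 → ℝ} (hV : ∀ i, Adm (V i))
    (hG : ∀ i, Tst (G i)) :
    Null (fun x => (∑ i, curlc V x i * G i x) - ∑ i, V i x * curlc G x i) := by
  have h1 : ∀ i j k, Null (fun x => V i x * pd j (G k) x + pd j (V i) x * G k x) :=
    fun i j k => null_mul_pd (hV i) (hG k) j
  refine (((((h1 2 1 0).sub (h1 1 2 0)).add (h1 0 2 1)).sub (h1 2 0 1)).add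
    ((h1 1 0 2).sub (h1 0 1 2))).congr fun x => ?_
  simp only [curlc, curl, Fin.sum_univ_three, Matrix.cons_val]
  ring

theorem curlc_mul {B : Fin 3 → V3 → ℝ} (hB : ∀ i, Adm (B i)) {φ : V3 → ℝ} (hφ : Adm φ) (x : V3) :
    curlc (fun i y => B i y * φ y) x =
      fun i => φ x * curlc B x i + cross3 (fun j => pd j φ x) (fun j => B j x) i := by
  funext i
  fin_cases i <;>
  simp [curlc, curl, cross3, pd_mul (hB _).smooth hφ.smooth] <;> ring

/-- The components of `(∇×b)×b`. -/
def lorentz (B : Fin 3 → V3 → ℝ) (i : Fin 3) (x : V3) : ℝ :=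
  cross3 (curlc B x) (fun j => B j x) i

theorem Adm.curlc {B : Fin 3 → V3 → ℝ} (hB : ∀ i, Adm (B i)) (i : Fin 3) :
    Adm (fun x => curlc B x i) := by
  fin_cases i
  · exact ((hB 2).pd 1).sub ((hB 1).pd 2)
  · exact ((hB 0).pd 2).sub ((hB 2).pd 0)
  · exact ((hB 1).pd 0).sub ((hB 0).pd 1)

theorem Adm.lorentz {B : Fin 3 → V3 → ℝ} (hB : ∀ i, Adm (B i)) (i : Fin 3) :
    Adm (lorentz B i) := by
  have h := Adm.curlc hB
  fin_cases i
  · exact ((h 1).mul (hB 2)).sub ((h 2).mul (hB 1))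
  · exact ((h 2).mul (hB 0)).sub ((h 0).mul (hB 2))
  · exact ((h 0).mul (hB 1)).sub ((h 1).mul (hB 0))

theorem null_hall {B : Fin 3 → V3 → ℝ} (hB : ∀ i, Adm (B i)) {φ : V3 → ℝ} (hφ : Tst φ) :
    Null (fun x => φ x * (∑ i, curlc (lorentz B) x i * B i x)
      - ∑ i, lorentz B i x * cross3 (fun j => pd j φ x) (fun j => B j x) i) := by
  refine (null_curl (Adm.lorentz hB) fun i => Tst.mul_left (hB i) hφ).congr fun x => ?_
  rw [curlc_mul hB hφ.toAdm]
  simp only [lorentz, cross3, Fin.sum_univ_three, Matrix.cons_val]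
  ring

/-! ### The localized energy identity -/

/-- Stationary MHD/Hall–MHD flows on `ℝ² × 𝕋`, componentwise and with periodic pressure. -/
structure Flow (δ : ℝ) (U B : Fin 3 → V3 → ℝ) (p : V3 → ℝ) : Prop where
  admU : ∀ i, Adm (U i)
  admB : ∀ i, Adm (B i)
  admP : Adm p
  divU : ∀ x, ∑ i, pd i (U i) x = 0
  divB : ∀ x, ∑ i, pd i (B i) x = 0
  mom : ∀ x i, adv U (U i) x + pd i p x - adv B (B i) x - lap (U i) x = 0
  ind : ∀ x i, adv U (B i) x - adv B (U i) x - lap (B i) x = δ * curlc (lorentz B) x i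

/-- The energy density `|∇u|² + |∇b|²`. -/
def dens (U B : Fin 3 → V3 → ℝ) (x : V3) : ℝ := ∑ i, (gdot (U i) (U i) x + gdot (B i) (B i) x)

/-- The flux terms of the energy identity that are linear in `∇u, ∇b`. -/
def flux (δ : ℝ) (U B : Fin 3 → V3 → ℝ) (φ Ψ Χ : V3 → ℝ) (x : V3) : ℝ :=
  - (∑ i, (U i x * gdot (U i) φ x + B i x * gdot (B i) φ x))
  - Ψ x * (∑ i, (U i x * pd 2 (U i) x + B i x * pd 2 (B i) x))
  + Χ x * (∑ i, (U i x * pd 2 (B i) x + B i x * pd 2 (U i) x))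
  + Ψ x * (adv U (U 2) x - adv B (B 2) x)
  + δ * ∑ i, lorentz B i x * cross3 (fun j => pd j φ x) (fun j => B j x) i

theorem Flow.null_energy {δ : ℝ} {U B : Fin 3 → V3 → ℝ} {p : V3 → ℝ} (h : Flow δ U B p)
    {φ Ψ Χ : V3 → ℝ} (hφ : Tst φ) (hΨ : Tst Ψ) (hΧ : Tst Χ)
    (hΨ2 : ∀ x, pd 2 Ψ x = adv U φ x) (hΧ2 : ∀ x, pd 2 Χ x = adv B φ x) :
    Null (fun x => φ x * dens U B x - flux δ U B φ Ψ Χ x - gdot (U 2) Ψ x) := by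
  have hU := h.admU
  have hB := h.admB
  have nU := Null.sum fun i => null_lap_mul (hU i) hφ
  have nB := Null.sum fun i => null_lap_mul (hB i) hφ
  have tU := Null.sum fun i => null_adv_mul hU h.divU (hU i) (hU i) hφ
  have tB := Null.sum fun i => null_adv_mul hU h.divU (hB i) (hB i) hφ
  have tX := Null.sum fun i => null_adv_mul hB h.divB (hU i) (hB i) hφ
  have tP := null_adv hU h.divU h.admP hφ
  have tZ := null_lap (hU 2) hΨ
  have tH := null_hall hB hφ
  have zQ := Null.sum fun i => null_mul_pd (((hU i).mul (hU i)).add ((hB i).mul (hB i))) hΨ 2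
  have zP := Null.sum fun i => null_mul_pd ((hU i).mul (hB i)) hΧ 2
  have zp := null_mul_pd h.admP hΨ 2
  refine ((((((((nU.add nB).sub ((tU.add tB).smul (1 / 2))).add tX).sub tP).sub tZ).add
    (tH.smul δ)).add (zQ.smul (1 / 2))).sub zP |>.add zp).congr fun x => ?_
  have m := h.mom x
  have n := h.ind x
  have hp : adv U p x = ∑ i, U i x * pd i p x := rfl
  simp only [dens, flux, hΨ2, hΧ2, hp, Fin.sum_univ_three,
    pd_add ((hU _).mul (hU _)).smooth ((hB _).mul (hB _)).smooth,
    pd_mul (hU _).smooth (hU _).smooth, pd_mul (hB _).smooth (hB _).smooth,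
    pd_mul (hU _).smooth (hB _).smooth]
  linear_combination (φ x * U 0 x) * m 0 + (φ x * U 1 x) * m 1 + (φ x * U 2 x) * m 2 +
    (φ x * B 0 x) * n 0 + (φ x * B 1 x) * n 1 + (φ x * B 2 x) * n 2 - Ψ x * m 2

/-! ### Radial cut-off functions -/

/-- The radial function `x ↦ F (|x'|² / R²)`. -/
def radial (F : ℝ → ℝ) (R : ℝ) (x : V3) : ℝ := F ((x 0 ^ 2 + x 1 ^ 2) / R ^ 2)

theorem adm_radial {F : ℝ → ℝ} (hF : ContDiff ℝ (⊤ : ℕ∞) F) (R : ℝ) : Adm (radial F R) :=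
  ⟨hF.comp (by fun_prop), fun x => by simp [radial]⟩

theorem pd_radial {F : ℝ → ℝ} (hF : ContDiff ℝ (⊤ : ℕ∞) F) (R : ℝ) (j : Fin 3) (x : V3) :
    pd j (radial F R) x =
      radial (deriv F) R x * (2 / R ^ 2 * if j = 2 then 0 else x j) := by
  have hs : ContDiff ℝ (⊤ : ℕ∞) (fun x : V3 => (x 0 ^ 2 + x 1 ^ 2) / R ^ 2) := by fun_prop
  have h1 : HasDerivAt F (deriv F ((x 0 ^ 2 + x 1 ^ 2) / R ^ 2)) ((x 0 ^ 2 + x 1 ^ 2) / R ^ 2) :=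
    ((hF.differentiable (by simp)) _).hasDerivAt
  have h2 := h1.comp_hasFDerivAt x (differentiableAt_of_contDiff hs x).hasFDerivAt
  have h3 : pd j (radial F R) x = radial (deriv F) R x *
      pd j (fun x : V3 => (x 0 ^ 2 + x 1 ^ 2) / R ^ 2) x := by
    simp only [pd]
    rw [show radial F R = F ∘ fun x : V3 => (x 0 ^ 2 + x 1 ^ 2) / R ^ 2 from rfl, h2.fderiv]
    rfl
  rw [h3]
  congr 1
  have hc : ∀ k : Fin 3, ContDiff ℝ (⊤ : ℕ∞) (fun x : V3 => x k) := fun k => by fun_prop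
  have : (fun x : V3 => (x 0 ^ 2 + x 1 ^ 2) / R ^ 2) =
      fun x => (1 / R ^ 2) * (x 0 * x 0 + x 1 * x 1) := by
    funext x; ring
  rw [this, pd_mul contDiff_const (by fun_prop), pd_add (by fun_prop) (by fun_prop),
    pd_mul (hc 0) (hc 0), pd_mul (hc 1) (hc 1), pd_const]
  simp only [pd_coord]
  fin_cases j <;> simp <;> ring

/-- A smooth function on `ℝ` equal to `1` on `(-∞, 1]` and to `0` on `[4, ∞)`. -/
def chi (s : ℝ) : ℝ := Real.smoothTransition ((4 - s) / 3)

theorem contDiff_chi : ContDiff ℝ (⊤ : ℕ∞) chi :=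
  Real.smoothTransition.contDiff.comp (by fun_prop)

theorem contDiff_deriv {F : ℝ → ℝ} (hF : ContDiff ℝ (⊤ : ℕ∞) F) : ContDiff ℝ (⊤ : ℕ∞) (deriv F) :=
  (contDiff_infty_iff_deriv.1 hF).2

theorem chi_eq_one {s : ℝ} (hs : s ≤ 1) : chi s = 1 :=
  Real.smoothTransition.one_of_one_le (by linarith)

theorem chi_eq_zero {s : ℝ} (hs : 4 ≤ s) : chi s = 0 :=
  Real.smoothTransition.zero_of_nonpos (by linarith)

theorem chi_nonneg (s : ℝ) : 0 ≤ chi s := Real.smoothTransition.nonneg _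

theorem chi_le_one (s : ℝ) : chi s ≤ 1 := Real.smoothTransition.le_one _

theorem chi_antitone : Antitone chi := fun s t h =>
  Real.smoothTransition.monotone (by linarith)

theorem deriv_eq_zero_of_off {F : ℝ → ℝ} {c : ℝ} (h1 : ∀ s < 1, F s = c) (h4 : ∀ s, 4 < s → F s = 0)
    {s : ℝ} (hs : s < 1 ∨ 4 < s) : deriv F s = 0 := by
  rcases hs with hs | hs
  · have : F =ᶠ[nhds s] fun _ => c := by
      filter_upwards [isOpen_Iio.mem_nhds hs] with t ht using h1 t ht
    simp [this.deriv_eq]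
  · have : F =ᶠ[nhds s] fun _ => 0 := by
      filter_upwards [isOpen_Ioi.mem_nhds hs] with t ht using h4 t ht
    simp [this.deriv_eq]

theorem deriv_chi_eq_zero {s : ℝ} (hs : s < 1 ∨ 4 < s) : deriv chi s = 0 :=
  deriv_eq_zero_of_off (fun _ h => chi_eq_one h.le) (fun _ h => chi_eq_zero h.le) hs

theorem deriv_deriv_chi_eq_zero {s : ℝ} (hs : s < 1 ∨ 4 < s) : deriv (deriv chi) s = 0 :=
  deriv_eq_zero_of_off (fun _ h => deriv_chi_eq_zero (Or.inl h))
    (fun _ h => deriv_chi_eq_zero (Or.inr h)) hs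

theorem exists_chi_bound : ∃ K : ℝ, 0 ≤ K ∧ ∀ s, |deriv chi s| ≤ K ∧ |deriv (deriv chi) s| ≤ K := by
  have c1 := contDiff_deriv contDiff_chi
  have c2 := contDiff_deriv c1
  obtain ⟨K1, h1⟩ := (isCompact_Icc (a := (1 : ℝ)) (b := 4)).exists_bound_of_continuousOn
    c1.continuous.continuousOn
  obtain ⟨K2, h2⟩ := (isCompact_Icc (a := (1 : ℝ)) (b := 4)).exists_bound_of_continuousOn
    c2.continuous.continuousOn
  refine ⟨max 0 (max K1 K2), le_max_left _ _, fun s => ?_⟩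
  by_cases hs : s ∈ Set.Icc (1 : ℝ) 4
  · exact ⟨(h1 s hs).trans ((le_max_left _ _).trans (le_max_right _ _)),
      (h2 s hs).trans ((le_max_right _ _).trans (le_max_right _ _))⟩
  · have hoff : s < 1 ∨ 4 < s := by
      by_contra! h
      exact hs h
    simp [deriv_chi_eq_zero hoff, deriv_deriv_chi_eq_zero hoff]

/-- The cut-off function, equal to `1` for `|x'| ≤ R` and to `0` for `|x'| ≥ 2R`. -/
def cut (R : ℝ) : V3 → ℝ := radial chi R

/-- The function `ψ` with `∂ⱼ φ = ψ xⱼ` for `j = 1, 2`, where `φ` is the cut-off function. -/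
def cutD (R : ℝ) (x : V3) : ℝ := 2 / R ^ 2 * radial (deriv chi) R x

/-- A cut-off function for the annulus containing the support of `cutD R`. -/
def ann (R : ℝ) (x : V3) : ℝ := cut (2 * R) x - cut (R / 2) x

theorem cylSupp_radial {F : ℝ → ℝ} (hF : ∀ s, 4 < s → F s = 0) {R : ℝ} (hR : 0 < R) :
    CylSupp (radial F R) := by
  refine ⟨4 * R ^ 2 + 1, fun x hx => hF _ ?_⟩
  rw [lt_div_iff₀ (by positivity)]
  linarith

theorem tst_cut {R : ℝ} (hR : 0 < R) : Tst (cut R) :=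
  ⟨adm_radial contDiff_chi R, cylSupp_radial (fun _ h => chi_eq_zero h.le) hR⟩

theorem tst_cutD {R : ℝ} (hR : 0 < R) : Tst (cutD R) :=
  Tst.mul_left (Adm.const _) ⟨adm_radial (contDiff_deriv contDiff_chi) R,
    cylSupp_radial (fun _ h => deriv_chi_eq_zero (Or.inr h)) hR⟩

theorem tst_ann {R : ℝ} (hR : 0 < R) : Tst (ann R) :=
  (tst_cut (by linarith)).sub (tst_cut (by linarith))

theorem pd_cut (R : ℝ) (j : Fin 3) (x : V3) :
    pd j (cut R) x = cutD R x * if j = 2 then 0 else x j := by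
  rw [cut, pd_radial contDiff_chi, cutD]
  ring

theorem pd_cutD (R : ℝ) (j : Fin 3) (x : V3) :
    pd j (cutD R) x = 4 / R ^ 4 * radial (deriv (deriv chi)) R x * if j = 2 then 0 else x j := by
  have h := contDiff_deriv contDiff_chi
  have : cutD R = fun x => 2 / R ^ 2 * radial (deriv chi) R x := rfl
  rw [this, pd_mul contDiff_const (adm_radial h R).smooth, pd_radial h, pd_const]
  ring

theorem cut_nonneg (R : ℝ) (x : V3) : 0 ≤ cut R x := chi_nonneg _

theorem cut_le_one (R : ℝ) (x : V3) : cut R x ≤ 1 := chi_le_one _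

theorem cut_mono {R S : ℝ} (hR : 0 < R) (h : R ≤ S) (x : V3) : cut R x ≤ cut S x := by
  apply chi_antitone
  gcongr

theorem cut_eq_one {R : ℝ} (hR : 0 < R) {x : V3} (h : x 0 ^ 2 + x 1 ^ 2 ≤ R ^ 2) : cut R x = 1 := by
  apply chi_eq_one
  rw [div_le_one (by positivity)]
  exact h

theorem cut_eq_zero {R : ℝ} (hR : 0 < R) {x : V3} (h : (2 * R) ^ 2 ≤ x 0 ^ 2 + x 1 ^ 2) :
    cut R x = 0 := by
  apply chi_eq_zero
  rw [le_div_iff₀ (by positivity)]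
  linarith

theorem ann_nonneg {R : ℝ} (hR : 0 < R) (x : V3) : 0 ≤ ann R x :=
  sub_nonneg.2 (cut_mono (by linarith) (by linarith) x)

theorem ann_le_one (R : ℝ) (x : V3) : ann R x ≤ 1 := by
  have := cut_le_one (2 * R) x
  have := cut_nonneg (R / 2) x
  simp only [ann]
  linarith

theorem exists_cut_bound : ∃ K : ℝ, 1 ≤ K ∧ ∀ R : ℝ, 0 < R → ∀ x : V3,
    (cutD R x = 0 ∧ ∀ j, pd j (cutD R) x = 0) ∨
    (ann R x = 1 ∧ (∀ j, j ≠ 2 → |x j| ≤ 2 * R) ∧ |cutD R x| ≤ K / R ^ 2 ∧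
      ∀ j, |pd j (cutD R) x| ≤ K / R ^ 3) := by
  obtain ⟨K, hK0, hK⟩ := exists_chi_bound
  refine ⟨8 * K + 1, by linarith, fun R hR x => ?_⟩
  by_cases hs : (x 0 ^ 2 + x 1 ^ 2) / R ^ 2 < 1 ∨ 4 < (x 0 ^ 2 + x 1 ^ 2) / R ^ 2
  · left
    refine ⟨by simp [cutD, radial, deriv_chi_eq_zero hs], fun j => ?_⟩
    rw [pd_cutD]
    simp [radial, deriv_deriv_chi_eq_zero hs]
  · right
    push Not at hs
    rw [one_le_div (by positivity), div_le_iff₀ (by positivity)] at hs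
    have hx : ∀ j : Fin 3, j ≠ 2 → |x j| ≤ 2 * R := by
      intro j hj
      apply abs_le_of_sq_le_sq _ (by linarith)
      fin_cases j
      · have := sq_nonneg (x 1); simp only [Fin.zero_eta]; linarith
      · have := sq_nonneg (x 0); simp only [Fin.mk_one]; linarith
      · simp at hj
    refine ⟨?_, hx, ?_, fun j => ?_⟩
    · rw [ann, cut_eq_one (by linarith) (by linarith), cut_eq_zero (by linarith), sub_zero]
      linarith
    · rw [cutD, abs_mul, abs_of_pos (show 0 < 2 / R ^ 2 by positivity), div_mul_eq_mul_div]
      gcongr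
      linarith [(hK ((x 0 ^ 2 + x 1 ^ 2) / R ^ 2)).1,
        show |radial (deriv chi) R x| ≤ K from (hK _).1]
    · rw [pd_cutD, abs_mul, abs_mul, abs_of_pos (show 0 < 4 / R ^ 4 by positivity)]
      have h1 : |if j = 2 then 0 else x j| ≤ 2 * R := by
        split_ifs with h
        · simp; linarith
        · exact hx j h
      have h2 : |radial (deriv (deriv chi)) R x| ≤ K := (hK _).2
      calc 4 / R ^ 4 * |radial (deriv (deriv chi)) R x| * |if j = 2 then 0 else x j|
          ≤ 4 / R ^ 4 * K * (2 * R) := by gcongr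
        _ = (8 * K) / R ^ 3 := by field_simp; ring
        _ ≤ (8 * K + 1) / R ^ 3 := by gcongr; linarith

theorem integral_ann_le {R : ℝ} (hR : 0 < R) : ∫ x in slab, ann R x ≤ 64 * R ^ 2 := by
  have hz : ∀ x : V3, (4 * R) ^ 2 ≤ x 0 ^ 2 + x 1 ^ 2 → ann R x = 0 := by
    intro x hx
    rw [ann, cut_eq_zero (by linarith) (by linarith), cut_eq_zero (by linarith), sub_zero]
    nlinarith
  rw [setIntegral_slab_eq_box (by positivity) hz]
  have hv := volume_box (L := 4 * R) (by positivity)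
  have hi : IntegrableOn (fun _ : V3 => (1 : ℝ)) (box (4 * R)) :=
    continuousOn_const.integrableOn_compact (isCompact_box _)
  have h1 : IntegrableOn (ann R) (box (4 * R)) :=
    (tst_ann hR).integrableOn.mono_set (box_subset_slab _)
  refine (setIntegral_mono h1 hi (ann_le_one R)).trans ?_
  simp only [integral_const, smul_eq_mul, mul_one, Measure.real, Measure.restrict_apply_univ, hv]
  rw [ENNReal.toReal_ofReal (by positivity)]
  apply le_of_eq; ring

theorem le_integral_cut {R : ℝ} (hR : 0 < R) : R ^ 2 ≤ ∫ x in slab, cut R x := by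
  have hv := volume_box (L := R / 2) (by positivity)
  calc R ^ 2 = ∫ x in box (R / 2), (1 : ℝ) := by
        simp only [integral_const, smul_eq_mul, mul_one, Measure.real,
          Measure.restrict_apply_univ, hv]
        rw [ENNReal.toReal_ofReal (by positivity)]
        ring
    _ = ∫ x in box (R / 2), cut R x := by
        refine setIntegral_congr_fun (measurableSet_box _) fun x hx => (cut_eq_one hR ?_).symm
        have h := mem_box.1 hx
        have h0 := sq_le_sq' (abs_le.1 h.1.1).1 (abs_le.1 h.1.1).2
        have h1 := sq_le_sq' (abs_le.1 h.1.2).1 (abs_le.1 h.1.2).2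
        nlinarith
    _ ≤ ∫ x in slab, cut R x :=
        setIntegral_mono_set (tst_cut hR).integrableOn
          (Filter.Eventually.of_forall fun x => cut_nonneg R x)
          (box_subset_slab _).eventuallyLE

/-! ### The stream function -/

section Parametric

variable {E : Type} [NormedAddCommGroup E] [NormedSpace ℝ E]

theorem hasFDerivAt_parametric_integral [CompleteSpace E] {F : V3 × ℝ → E} (hF : ContDiff ℝ 1 F)
    (x₀ : V3) :
    HasFDerivAt (fun x => ∫ t in (0 : ℝ)..1, F (x, t))
      (∫ t in (0 : ℝ)..1, (fderiv ℝ F (x₀, t)).comp (ContinuousLinearMap.inl ℝ V3 ℝ)) x₀ := by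
  have hG : Continuous fun q : V3 × ℝ => (fderiv ℝ F q).comp (ContinuousLinearMap.inl ℝ V3 ℝ) :=
    (hF.continuous_fderiv one_ne_zero).clm_comp continuous_const
  obtain ⟨C, hC⟩ := ((isCompact_closedBall x₀ (1 : ℝ)).prod
    (isCompact_Icc (a := (0 : ℝ)) (b := 1))).exists_bound_of_continuousOn hG.continuousOn
  refine intervalIntegral.hasFDerivAt_integral_of_dominated_of_fderiv_le
    (F := fun x t => F (x, t))
    (F' := fun x t => (fderiv ℝ F (x, t)).comp (ContinuousLinearMap.inl ℝ V3 ℝ))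
    (bound := fun _ => C) (Metric.closedBall_mem_nhds x₀ one_pos) ?_ ?_ ?_ ?_ ?_ ?_
  · refine Filter.Eventually.of_forall fun x => ?_
    exact (hF.continuous.comp (by fun_prop)).aestronglyMeasurable
  · exact (hF.continuous.comp (by fun_prop)).intervalIntegrable _ _
  · exact (hG.comp (by fun_prop : Continuous fun t : ℝ => (x₀, t))).aestronglyMeasurable
  · refine Filter.Eventually.of_forall fun t ht x hx => hC (x, t) ⟨hx, ?_⟩
    rw [Set.uIoc_of_le zero_le_one] at ht
    exact Set.Ioc_subset_Icc_self ht
  · exact intervalIntegrable_const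
  · refine Filter.Eventually.of_forall fun t _ x _ => ?_
    exact ((hF.differentiable one_ne_zero) (x, t)).hasFDerivAt.comp x
      (hasFDerivAt_prodMk_left x t)

end Parametric

theorem contDiff_parametric_integral_nat (n : ℕ) : ∀ (E : Type) [NormedAddCommGroup E]
    [NormedSpace ℝ E] [CompleteSpace E] (F : V3 × ℝ → E), ContDiff ℝ (⊤ : ℕ∞) F →
    ContDiff ℝ n (fun x => ∫ t in (0 : ℝ)..1, F (x, t)) := by
  induction n with
  | zero =>
    intro E _ _ _ F hF
    rw [Nat.cast_zero, contDiff_zero, continuous_iff_continuousAt]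
    exact fun x => (hasFDerivAt_parametric_integral (hF.of_le (by simp)) x).continuousAt
  | succ n ih =>
    intro E _ _ _ F hF
    have hd := fun x => hasFDerivAt_parametric_integral (hF.of_le (by simp)) x
    rw [Nat.cast_add, Nat.cast_one, contDiff_succ_iff_fderiv]
    refine ⟨fun x => (hd x).differentiableAt, by simp, ?_⟩
    rw [show fderiv ℝ (fun x => ∫ t in (0 : ℝ)..1, F (x, t)) = _ from funext fun x => (hd x).fderiv]
    have h : ContDiff ℝ (⊤ : ℕ∞) (fderiv ℝ F) := hF.fderiv_right (by simp)
    exact ih _ _ (h.clm_comp contDiff_const)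

theorem contDiff_parametric_integral {F : V3 × ℝ → ℝ} (hF : ContDiff ℝ (⊤ : ℕ∞) F) :
    ContDiff ℝ (⊤ : ℕ∞) (fun x => ∫ t in (0 : ℝ)..1, F (x, t)) :=
  contDiff_infty.2 fun n => contDiff_parametric_integral_nat n ℝ F hF

theorem pd_parametric_integral {F : V3 × ℝ → ℝ} (hF : ContDiff ℝ (⊤ : ℕ∞) F) (i : Fin 3) (x : V3) :
    pd i (fun x => ∫ t in (0 : ℝ)..1, F (x, t)) x =
      ∫ t in (0 : ℝ)..1, pd i (fun x => F (x, t)) x := by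
  have h1 : ContDiff ℝ 1 F := hF.of_le (by simp)
  have hG : Continuous fun q : V3 × ℝ => (fderiv ℝ F q).comp (ContinuousLinearMap.inl ℝ V3 ℝ) :=
    (h1.continuous_fderiv one_ne_zero).clm_comp continuous_const
  have hi : IntervalIntegrable
      (fun t : ℝ => (fderiv ℝ F (x, t)).comp (ContinuousLinearMap.inl ℝ V3 ℝ)) volume 0 1 :=
    (hG.comp (by fun_prop : Continuous fun t : ℝ => (x, t))).intervalIntegrable _ _
  simp only [pd]
  rw [(hasFDerivAt_parametric_integral h1 x).fderiv, ContinuousLinearMap.intervalIntegral_apply hi]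
  refine intervalIntegral.integral_congr fun t _ => ?_
  have h : HasFDerivAt (fun x => F (x, t))
      ((fderiv ℝ F (x, t)).comp (ContinuousLinearMap.inl ℝ V3 ℝ)) x :=
    ((h1.differentiable one_ne_zero) (x, t)).hasFDerivAt.comp x (hasFDerivAt_prodMk_left x t)
  simp only [h.fderiv]

theorem pd_comp_linear {f : V3 → ℝ} (hf : ContDiff ℝ (⊤ : ℕ∞) f) (A : V3 →L[ℝ] V3) (i : Fin 3)
    (x : V3) : pd i (fun y => f (A y)) x = fderiv ℝ f (A x) (A (Pi.single i 1)) := by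
  have h := (differentiableAt_of_contDiff hf (A x)).hasFDerivAt.comp x A.hasFDerivAt
  have h' : HasFDerivAt (fun y => f (A y)) _ x := h
  rw [pd, h'.fderiv]
  rfl

theorem fderiv_apply_eq_sum {f : V3 → ℝ} (x v : V3) : fderiv ℝ f x v = ∑ i, v i * pd i f x := by
  conv_lhs => rw [pi_eq_sum_univ' v]
  simp [pd, map_sum]

/-- The horizontal scaling `(x', x₃) ↦ (t x', x₃)`. -/
def hscale (t : ℝ) : V3 →L[ℝ] V3 :=
  t • ContinuousLinearMap.id ℝ V3 +
    (1 - t) • (ContinuousLinearMap.proj (R := ℝ) (φ := fun _ : Fin 3 => ℝ) 2).smulRight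
      (Pi.single 2 1 : V3)

theorem hscale_apply (t : ℝ) (x : V3) :
    hscale t x = t • x + ((1 - t) * x 2) • (Pi.single 2 1 : V3) := by
  simp [hscale, smul_smul]

theorem hscale_zero (t : ℝ) (x : V3) : hscale t x 0 = t * x 0 := by simp [hscale_apply]

theorem hscale_one (t : ℝ) (x : V3) : hscale t x 1 = t * x 1 := by simp [hscale_apply]

theorem hscale_single (t : ℝ) : hscale t (Pi.single 2 1) = Pi.single 2 1 := by
  rw [hscale_apply, ← add_smul]
  simp

theorem hscale_by_one (x : V3) : hscale 1 x = x := by simp [hscale_apply]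

theorem hasDerivAt_comp_hscale {f : V3 → ℝ} (hf : ContDiff ℝ (⊤ : ℕ∞) f) (x : V3) (t : ℝ) :
    HasDerivAt (fun t => f (hscale t x))
      (x 0 * pd 0 f (hscale t x) + x 1 * pd 1 f (hscale t x)) t := by
  have h1 : HasDerivAt (fun t : ℝ => hscale t x) (x - x 2 • (Pi.single 2 1 : V3)) t := by
    have h2 : HasDerivAt (fun t : ℝ => t • x + ((1 - t) * x 2) • (Pi.single 2 1 : V3))
        ((1 : ℝ) • x + ((-1) * x 2) • (Pi.single 2 1 : V3)) t :=
      ((hasDerivAt_id t).smul_const x).add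
        ((((hasDerivAt_id t).const_sub 1).mul_const (x 2)).smul_const _)
    simp only [hscale_apply]
    convert h2 using 1
    simp [sub_eq_add_neg]
  have h := (differentiableAt_of_contDiff hf (hscale t x)).hasFDerivAt.comp_hasDerivAt t h1
  rw [fderiv_apply_eq_sum] at h
  have h0 : (0 : Fin 3) ≠ 2 := by decide
  have h1 : (1 : Fin 3) ≠ 2 := by decide
  simpa [Function.comp_def, Fin.sum_univ_three, Pi.single_apply, h0, h1] using h

/-- The function `r uʳ`. -/
def rad (U : Fin 3 → V3 → ℝ) (x : V3) : ℝ := x 0 * U 0 x + x 1 * U 1 x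

/-- The function `r u^θ`. -/
def swirl (U : Fin 3 → V3 → ℝ) (x : V3) : ℝ := x 0 * U 1 x - x 1 * U 0 x

theorem adm_rad {U : Fin 3 → V3 → ℝ} (hU : ∀ i, Adm (U i)) : Adm (rad U) :=
  ((Adm.coord (by decide)).mul (hU 0)).add ((Adm.coord (by decide)).mul (hU 1))

theorem pd_rad {U : Fin 3 → V3 → ℝ} (hU : ∀ i, Adm (U i)) (j : Fin 3) (x : V3) :
    pd j (rad U) x = (if 0 = j then 1 else 0) * U 0 x + x 0 * pd j (U 0) x +
      ((if 1 = j then 1 else 0) * U 1 x + x 1 * pd j (U 1) x) := by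
  have hc : ∀ k : Fin 3, ContDiff ℝ (⊤ : ℕ∞) (fun x : V3 => x k) := fun k => by fun_prop
  have : rad U = fun x => x 0 * U 0 x + x 1 * U 1 x := rfl
  rw [this, pd_add ((hc 0).mul (hU 0).smooth) ((hc 1).mul (hU 1).smooth),
    pd_mul (hc 0) (hU 0).smooth, pd_mul (hc 1) (hU 1).smooth, pd_coord, pd_coord]
  ring

theorem euler_rad {U : Fin 3 → V3 → ℝ} (hU : ∀ i, Adm (U i))
    (hdiv : ∀ x, ∑ i, pd i (U i) x = 0)
    (hax : ∀ x, x 0 * pd 1 (swirl U) x - x 1 * pd 0 (swirl U) x = 0) (x : V3) :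
    x 0 * pd 0 (rad U) x + x 1 * pd 1 (rad U) x = -(x 0 ^ 2 + x 1 ^ 2) * pd 2 (U 2) x := by
  have hc : ∀ k : Fin 3, ContDiff ℝ (⊤ : ℕ∞) (fun x : V3 => x k) := fun k => by fun_prop
  have hs : swirl U = fun x => x 0 * U 1 x - x 1 * U 0 x := rfl
  have h1 := hax x
  rw [hs] at h1
  simp only [pd_sub ((hc 0).mul (hU 1).smooth) ((hc 1).mul (hU 0).smooth),
    pd_mul (hc _) (hU _).smooth, pd_coord] at h1
  have h2 := hdiv x
  rw [Fin.sum_univ_three] at h2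
  rw [pd_rad hU, pd_rad hU]
  simp at h1 ⊢
  linear_combination (x 0 ^ 2 + x 1 ^ 2) * h2 - h1

theorem exists_stream {U : Fin 3 → V3 → ℝ} (hU : ∀ i, Adm (U i))
    (hdiv : ∀ x, ∑ i, pd i (U i) x = 0)
    (hax : ∀ x, x 0 * pd 1 (swirl U) x - x 1 * pd 0 (swirl U) x = 0) :
    ∃ W : V3 → ℝ, Adm W ∧ (∀ x, pd 2 W x = rad U x) ∧ ∀ x, x 2 = 0 → W x = 0 := by
  set F : V3 × ℝ → ℝ := fun q => -(q.1 0 ^ 2 + q.1 1 ^ 2) * q.2 * U 2 (hscale q.2 q.1) with hFdef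
  have hF : ContDiff ℝ (⊤ : ℕ∞) F := by
    have h1 : ContDiff ℝ (⊤ : ℕ∞) fun q : V3 × ℝ => U 2 (hscale q.2 q.1) := by
      simp only [hscale_apply]
      exact (hU 2).smooth.comp (by fun_prop)
    exact ContDiff.mul (by fun_prop) h1
  set V : V3 → ℝ := fun x => ∫ t in (0 : ℝ)..1, F (x, t) with hV
  have hVs : ContDiff ℝ (⊤ : ℕ∞) V := contDiff_parametric_integral hF
  have hV2 : ∀ x, pd 2 V x = rad U x := by
    intro x
    rw [hV, pd_parametric_integral hF]
    have hr := (adm_rad hU).smooth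
    have ftc := intervalIntegral.integral_eq_sub_of_hasDerivAt (a := 0) (b := 1)
      (fun t _ => hasDerivAt_comp_hscale hr x t) (Continuous.intervalIntegrable (by
        have hh : Continuous fun t => hscale t x := by
          simp only [hscale_apply]; fun_prop
        exact (continuous_const.mul ((contDiff_pd hr).continuous.comp hh)).add
          (continuous_const.mul ((contDiff_pd hr).continuous.comp hh))) _ _)
    have h0 : rad U (hscale 0 x) = 0 := by simp [rad, hscale_zero, hscale_one]
    rw [hscale_by_one, h0, sub_zero] at ftc
    rw [← ftc]
    refine intervalIntegral.integral_congr_ae (Filter.Eventually.of_forall fun t ht => ?_)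
    rw [Set.uIoc_of_le zero_le_one] at ht
    have hE := euler_rad hU hdiv hax (hscale t x)
    rw [hscale_zero, hscale_one] at hE
    have hq : ContDiff ℝ (⊤ : ℕ∞) (fun x : V3 => -(x 0 ^ 2 + x 1 ^ 2) * t) := by fun_prop
    have hq2 : pd 2 (fun x : V3 => -(x 0 ^ 2 + x 1 ^ 2) * t) x = 0 := by
      have hc : ∀ k : Fin 3, ContDiff ℝ (⊤ : ℕ∞) (fun x : V3 => x k) := fun k => by fun_prop
      rw [show (fun x : V3 => -(x 0 ^ 2 + x 1 ^ 2) * t) =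
        fun x => (-t) * (x 0 * x 0 + x 1 * x 1) by funext x; ring,
        pd_mul contDiff_const (by fun_prop), pd_add (by fun_prop) (by fun_prop),
        pd_mul (hc 0) (hc 0), pd_mul (hc 1) (hc 1), pd_const]
      simp [pd_coord]
    have hL : pd 2 (fun x => F (x, t)) x = -(x 0 ^ 2 + x 1 ^ 2) * t * pd 2 (U 2) (hscale t x) := by
      have hcmp : ContDiff ℝ (⊤ : ℕ∞) (fun x => U 2 (hscale t x)) :=
        (hU 2).smooth.comp (hscale t).contDiff
      simp only [hFdef]
      rw [pd_mul hq hcmp, hq2,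
        pd_comp_linear (hU 2).smooth, hscale_single]
      simp [pd]
    rw [hL]
    have ht0 : t ≠ 0 := ht.1.ne'
    apply mul_left_cancel₀ ht0
    linear_combination -hE
  have hVp : ZPer V := by
    intro x
    simp only [hV, hFdef, map_add, hscale_single, (hU 2).per _]
    simp
  set Pr : V3 →L[ℝ] V3 := ContinuousLinearMap.id ℝ V3 -
    (ContinuousLinearMap.proj (R := ℝ) (φ := fun _ : Fin 3 => ℝ) 2).smulRight
      (Pi.single 2 1 : V3) with hPr
  have hPs : Pr (Pi.single 2 1) = 0 := by simp [hPr]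
  have hPc : ContDiff ℝ (⊤ : ℕ∞) fun x => V (Pr x) := hVs.comp Pr.contDiff
  refine ⟨fun x => V x - V (Pr x), ⟨hVs.sub hPc, fun x => ?_⟩, fun x => ?_, fun x hx => ?_⟩
  · simp only [hVp x, map_add, hPs, add_zero]
  · rw [pd_sub hVs hPc, hV2, pd_comp_linear hVs, hPs]
    simp
  · have : Pr x = x := by simp [hPr, hx]
    simp only [this, sub_self]

theorem swirl_invariant {u : V3 → V3} (hu : ContDiff ℝ (⊤ : ℕ∞) u) (hax : AxiSym (compTheta u))
    (x : V3) :
    x 0 * pd 1 (swirl fun i y => u y i) x - x 1 * pd 0 (swirl fun i y => u y i) x = 0 := by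
  set h : V3 → ℝ := swirl fun i y => u y i with hh
  have hs : ContDiff ℝ (⊤ : ℕ∞) h := by
    have hc : ∀ k : Fin 3, ContDiff ℝ (⊤ : ℕ∞) (fun x : V3 => x k) := fun k => by fun_prop
    have hu' := contDiff_pi.1 hu
    exact ((hc 0).mul (hu' 1)).sub ((hc 1).mul (hu' 0))
  obtain ⟨r, θ, h0, h1⟩ : ∃ r θ : ℝ, x 0 = r * Real.cos θ ∧ x 1 = r * Real.sin θ :=
    ⟨‖(⟨x 0, x 1⟩ : ℂ)‖, Complex.arg ⟨x 0, x 1⟩, (Complex.norm_mul_cos_arg ⟨x 0, x 1⟩).symm,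
      (Complex.norm_mul_sin_arg ⟨x 0, x 1⟩).symm⟩
  have hx : cylPt r θ (x 2) = x := by
    funext i
    fin_cases i <;> simp [cylPt, h0, h1]
  have hγ : HasDerivAt (fun s => cylPt r s (x 2)) ![-(r * Real.sin θ), r * Real.cos θ, 0] θ := by
    rw [hasDerivAt_pi]
    intro i
    fin_cases i
    · simpa [cylPt] using (Real.hasDerivAt_cos θ).const_mul r
    · simpa [cylPt] using (Real.hasDerivAt_sin θ).const_mul r
    · simpa [cylPt] using hasDerivAt_const θ (x 2)
  have hd := (differentiableAt_of_contDiff hs (cylPt r θ (x 2))).hasFDerivAt.comp_hasDerivAt θ hγ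
  have hconst : (h ∘ fun s => cylPt r s (x 2)) = fun _ => r * compTheta u r θ (x 2) := by
    funext s
    rw [hax r θ s (x 2)]
    simp [hh, swirl, compTheta, cylPt]
    ring
  rw [hconst] at hd
  have h2 := hd.unique (hasDerivAt_const _ _)
  rw [fderiv_apply_eq_sum, hx, Fin.sum_univ_three] at h2
  simp at h2
  rw [h0, h1]
  linarith

/-! ### Periodicity of the pressure -/

theorem adv_cut (U : Fin 3 → V3 → ℝ) (R : ℝ) (x : V3) :
    adv U (cut R) x = cutD R x * rad U x := by
  simp only [adv, pd_cut, rad, Fin.sum_univ_three]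
  simp
  ring

theorem abs_rad_le {U : Fin 3 → V3 → ℝ} {M R : ℝ} (hM : ∀ i x, |U i x| ≤ M) {x : V3}
    (hx : ∀ j : Fin 3, j ≠ 2 → |x j| ≤ R) : |rad U x| ≤ 2 * R * M := by
  have h0 := hx 0 (by decide)
  have h1 := hx 1 (by decide)
  have hR := (abs_nonneg _).trans h0
  calc |rad U x| ≤ |x 0 * U 0 x| + |x 1 * U 1 x| := abs_add_le _ _
    _ ≤ R * M + R * M := by
      rw [abs_mul, abs_mul]
      gcongr <;> exact hM _ _
    _ = _ := by ring

theorem exists_slope {p : V3 → ℝ} (hp : ContDiff ℝ (⊤ : ℕ∞) p) (h : ∀ i, ZPer (pd i p)) :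
    ∃ c, ∀ x, p (x + Pi.single 2 1) = p x + c := by
  have hs : ContDiff ℝ (⊤ : ℕ∞) fun x : V3 => p (x + Pi.single 2 1) := hp.comp (by fun_prop)
  have hg : Differentiable ℝ fun x : V3 => p (x + Pi.single 2 1) - p x :=
    (hs.sub hp).differentiable (by simp)
  have hz : ∀ x, fderiv ℝ (fun x : V3 => p (x + Pi.single 2 1) - p x) x = 0 := by
    intro x
    ext v
    rw [fderiv_apply_eq_sum]
    refine Finset.sum_eq_zero fun i _ => ?_
    have h1 : pd i (fun x : V3 => p (x + Pi.single 2 1)) x = pd i p (x + Pi.single 2 1) := by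
      simp only [pd, fderiv_comp_add_right]
    rw [pd_sub hs hp, h1, h i x, sub_self, mul_zero]
  refine ⟨p (0 + Pi.single 2 1) - p 0, fun x => ?_⟩
  have := is_const_of_fderiv_eq_zero hg hz x 0
  linarith

theorem abs_lap_cut_le {K R : ℝ} (hR : 0 < R) {x : V3} (hx : ∀ j : Fin 3, j ≠ 2 → |x j| ≤ 2 * R)
    (h0 : |cutD R x| ≤ K / R ^ 2) (h1 : ∀ j, |pd j (cutD R) x| ≤ K / R ^ 3) :
    |lap (cut R) x| ≤ 6 * K / R ^ 2 := by
  have hc : ∀ k : Fin 3, ContDiff ℝ (⊤ : ℕ∞) (fun x : V3 => x k) := fun k => by fun_prop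
  have hD := (tst_cutD hR).smooth
  have e : ∀ j : Fin 3, j ≠ 2 → pd j (cut R) = fun x => cutD R x * x j := fun j hj => by
    funext y; simp [pd_cut, hj]
  have e2 : pd 2 (cut R) = fun _ => 0 := by funext y; simp [pd_cut]
  have hj : ∀ j : Fin 3, j ≠ 2 → |pd j (pd j (cut R)) x| ≤ 3 * K / R ^ 2 := by
    intro j hj
    rw [e j hj, pd_mul hD (hc j), pd_coord, if_pos rfl, mul_one]
    calc _ ≤ |cutD R x| + |pd j (cutD R) x * x j| := abs_add_le _ _
      _ ≤ K / R ^ 2 + K / R ^ 3 * (2 * R) := by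
        rw [abs_mul]
        have := (abs_nonneg _).trans (h1 0)
        gcongr
        exacts [h1 j, hx j hj]
      _ = _ := by field_simp; ring
  rw [lap, Fin.sum_univ_three, e2, pd_const, add_zero]
  calc _ ≤ |pd 0 (pd 0 (cut R)) x| + |pd 1 (pd 1 (cut R)) x| := abs_add_le _ _
    _ ≤ 3 * K / R ^ 2 + 3 * K / R ^ 2 := add_le_add (hj 0 (by decide)) (hj 1 (by decide))
    _ = _ := by ring

theorem abs_setIntegral_le {f g : V3 → ℝ} (hf : IntegrableOn f slab) (hg : IntegrableOn g slab)
    (h : ∀ x, |f x| ≤ g x) : |∫ x in slab, f x| ≤ ∫ x in slab, g x :=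
  (abs_integral_le_integral_abs).trans (integral_mono hf.abs hg h)

theorem slope_eq_zero {U B : Fin 3 → V3 → ℝ} {q : V3 → ℝ} {M c : ℝ}
    (hU : ∀ i, Adm (U i)) (hB : ∀ i, Adm (B i)) (hq : Adm q)
    (hdU : ∀ x, ∑ i, pd i (U i) x = 0) (hdB : ∀ x, ∑ i, pd i (B i) x = 0)
    (hmom : ∀ x, adv U (U 2) x + (pd 2 q x + c) - adv B (B 2) x - lap (U 2) x = 0)
    (hMU : ∀ i x, |U i x| ≤ M) (hMB : ∀ i x, |B i x| ≤ M) : c = 0 := by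
  obtain ⟨K, hK1, hK⟩ := exists_cut_bound
  have hM : 0 ≤ M := (abs_nonneg _).trans (hMU 0 0)
  have key : ∀ R : ℝ, 1 ≤ R → |c| * R ≤ 64 * (8 * K * M ^ 2 + 6 * K * M) := by
    intro R hR1
    have hR : 0 < R := by linarith
    have hφ := tst_cut hR
    set S : V3 → ℝ := fun x => U 2 x * adv U (cut R) x - B 2 x * adv B (cut R) x +
      U 2 x * lap (cut R) x with hS
    have hN : Null fun x => S x - c * cut R x := by
      have n5 := Null.sum fun j => null_mul_pd (hU 2) (hφ.pd j) j
      refine ((((null_adv hU hdU (hU 2) hφ).sub (null_adv hB hdB (hB 2) hφ)).add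
        (null_mul_pd hq hφ 2)).sub (null_lap (hU 2) hφ) |>.add n5).congr fun x => ?_
      have h2 : pd 2 (cut R) x = 0 := by simp [pd_cut]
      have m := hmom x
      have eL : lap (cut R) x = ∑ j, pd j (pd j (cut R)) x := rfl
      simp only [hS, eL, gdot, Fin.sum_univ_three, h2]
      linear_combination (-cut R x) * m
    have hcI : IntegrableOn (fun x => c * cut R x) slab := hφ.integrableOn.const_mul c
    have hSI : IntegrableOn S slab :=
      (hN.1.add hcI).congr_fun (fun x _ => by simp) measurableSet_slab
    have hEq : c * ∫ x in slab, cut R x = ∫ x in slab, S x := by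
      have := hN.2
      rw [integral_sub hSI hcI, integral_const_mul] at this
      linarith
    set D := (8 * K * M ^ 2 + 6 * K * M) / R with hD
    have hb : ∀ x, |S x| ≤ D * ann R x := by
      intro x
      have hrad : ∀ V : Fin 3 → V3 → ℝ, adv V (cut R) x = cutD R x * rad V x :=
        fun V => adv_cut V R x
      rcases hK R hR x with ⟨h0, h1⟩ | ⟨ha, hx, h0, h1⟩
      · have hl : lap (cut R) x = 0 := by
          have e : ∀ j : Fin 3, pd j (cut R) = fun x => cutD R x * if j = 2 then 0 else x j :=
            fun j => funext fun y => pd_cut R j y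
          have hs : ∀ j : Fin 3, ContDiff ℝ (⊤ : ℕ∞) fun x : V3 => if j = 2 then 0 else x j := by
            intro j
            split_ifs <;> fun_prop
          rw [lap]
          refine Finset.sum_eq_zero fun j _ => ?_
          rw [e, pd_mul (tst_cutD hR).smooth (hs j), h0, h1]
          simp
        simp only [hS, hrad, h0, hl]
        simpa using mul_nonneg (by positivity) (ann_nonneg hR x)
      · rw [ha, mul_one]
        have hl := abs_lap_cut_le hR hx h0 h1
        have hK0 : 0 ≤ K := by linarith
        have t : ∀ V : Fin 3 → V3 → ℝ, (∀ i x, |V i x| ≤ M) →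
            |V 2 x * adv V (cut R) x| ≤ 4 * K * M ^ 2 / R := by
          intro V hV
          rw [hrad, abs_mul, abs_mul]
          calc _ ≤ M * (K / R ^ 2 * (2 * (2 * R) * M)) := by
                gcongr
                exacts [hV 2 x, abs_rad_le hV hx]
            _ = _ := by field_simp; ring
        have t3 : |U 2 x * lap (cut R) x| ≤ 6 * K * M / R := by
          rw [abs_mul]
          calc _ ≤ M * (6 * K / R ^ 2) := by gcongr; exact hMU 2 x
            _ = 6 * K * M / R * (1 / R) := by field_simp
            _ ≤ 6 * K * M / R * 1 := by
              gcongr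
              rw [div_le_one hR]; exact hR1
            _ = _ := mul_one _
        have h4 := abs_add_le (U 2 x * adv U (cut R) x - B 2 x * adv B (cut R) x)
          (U 2 x * lap (cut R) x)
        have h5 := abs_sub (U 2 x * adv U (cut R) x) (B 2 x * adv B (cut R) x)
        have h6 : D = 4 * K * M ^ 2 / R + 4 * K * M ^ 2 / R + 6 * K * M / R := by
          rw [hD]; ring
        rw [h6]
        linarith [t U hMU, t B hMB]
    have hI := abs_setIntegral_le hSI ((tst_ann hR).integrableOn.const_mul D) hb
    rw [← hEq, integral_const_mul, abs_mul] at hI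
    have h1 := le_integral_cut hR
    have h2 := integral_ann_le hR
    have hK0 : 0 ≤ K := by linarith
    have hD0 : 0 ≤ D := by positivity
    rw [abs_of_nonneg ((sq_nonneg R).trans h1)] at hI
    have h3 : |c| * R ^ 2 ≤ D * (64 * R ^ 2) :=
      (mul_le_mul_of_nonneg_left h1 (abs_nonneg c)).trans
        (hI.trans (mul_le_mul_of_nonneg_left h2 hD0))
    have h4 : D * (64 * R ^ 2) = 64 * (8 * K * M ^ 2 + 6 * K * M) * R := by
      rw [hD]; field_simp
    rw [h4, pow_two, ← mul_assoc] at h3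
    exact le_of_mul_le_mul_right h3 hR
  by_contra hc
  have hc' : 0 < |c| := abs_pos.2 hc
  set N := 64 * (8 * K * M ^ 2 + 6 * K * M) with hN
  have := key (|N| / |c| + 1) (by
    have : 0 ≤ |N| / |c| := by positivity
    linarith)
  have e : |c| * (|N| / |c| + 1) = |N| + |c| := by field_simp
  rw [e] at this
  linarith [le_abs_self N]

theorem exists_periodic_pressure {δ M : ℝ} {U B : Fin 3 → V3 → ℝ} {p : V3 → ℝ}
    (hU : ∀ i, Adm (U i)) (hB : ∀ i, Adm (B i)) (hp : ContDiff ℝ (⊤ : ℕ∞) p)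
    (hdU : ∀ x, ∑ i, pd i (U i) x = 0) (hdB : ∀ x, ∑ i, pd i (B i) x = 0)
    (hmom : ∀ x i, adv U (U i) x + pd i p x - adv B (B i) x - lap (U i) x = 0)
    (hind : ∀ x i, adv U (B i) x - adv B (U i) x - lap (B i) x = δ * curlc (lorentz B) x i)
    (hMU : ∀ i x, |U i x| ≤ M) (hMB : ∀ i x, |B i x| ≤ M) : Flow δ U B p := by
  have hper : ∀ i, ZPer (pd i p) := by
    intro i
    have e : pd i p = fun x => lap (U i) x + adv B (B i) x - adv U (U i) x := by
      funext x
      linarith [hmom x i]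
    rw [e]
    exact (((hU i).lap.add (Adm.adv hB (hB i))).sub (Adm.adv hU (hU i))).per
  obtain ⟨c, hc⟩ := exists_slope hp hper
  have hq : Adm fun x => p x - c * x 2 := by
    refine ⟨hp.sub (by fun_prop), fun x => ?_⟩
    simp only [hc, Pi.add_apply, Pi.single_eq_same]
    ring
  have hl : ContDiff ℝ (⊤ : ℕ∞) fun x : V3 => c * x 2 := by fun_prop
  have h2 : ∀ x, pd 2 (fun x => p x - c * x 2) x + c = pd 2 p x := by
    intro x
    rw [pd_sub hp hl, pd_mul contDiff_const (by fun_prop), pd_coord, pd_const]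
    simp
  have c0 : c = 0 := slope_eq_zero hU hB hq hdU hdB
    (fun x => by rw [h2]; exact hmom x 2) hMU hMB
  exact ⟨hU, hB, ⟨hp, fun x => by rw [hc, c0, add_zero]⟩, hdU, hdB, hmom, hind⟩

/-! ### The Caccioppoli-type estimate -/

theorem integral_sq_le_integral_pd_sq {G : V3 → ℝ} (hG : Tst G) (h0 : ∀ x, x 2 = 0 → G x = 0) :
    ∫ x in slab, G x ^ 2 ≤ 4 * ∫ x in slab, pd 2 G x ^ 2 := by
  have hz : ContDiff ℝ (⊤ : ℕ∞) fun x : V3 => x 2 := by fun_prop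
  have hG2 : Tst fun x => G x * G x := Tst.mul_left hG.toAdm hG
  have hs : ContDiff ℝ (⊤ : ℕ∞) fun x : V3 => x 2 * (G x * G x) := hz.mul hG2.smooth
  have hc : CylSupp fun x : V3 => x 2 * (G x * G x) := by
    obtain ⟨L, hL⟩ := hG2.supp
    exact ⟨L, fun x hx => mul_eq_zero_of_right _ (hL x hx)⟩
  have hI := setIntegral_slab_pd_eq_zero hs hc (fun x hx => by
    rw [hG.per, h0 x hx, mul_zero, mul_zero, mul_zero]) 2
  have e : ∀ x, pd 2 (fun x : V3 => x 2 * (G x * G x)) x = G x ^ 2 + 2 * x 2 * G x * pd 2 G x := by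
    intro x
    rw [pd_mul hz hG2.smooth, pd_mul hG.smooth hG.smooth, pd_coord, if_pos rfl]
    ring
  have iG : IntegrableOn (fun x => G x ^ 2) slab := by
    simpa only [pow_two] using hG2.integrableOn
  have iP : IntegrableOn (fun x => pd 2 G x ^ 2) slab := by
    simpa only [pow_two] using (Tst.mul_left (hG.pd 2).toAdm (hG.pd 2)).integrableOn
  have iT : IntegrableOn (fun x => pd 2 (fun x : V3 => x 2 * (G x * G x)) x) slab :=
    (CylSupp.pd hc 2).integrableOn (contDiff_pd hs).continuous
  have hle : ∫ x in slab, (1 / 2 * G x ^ 2 - 2 * pd 2 G x ^ 2) ≤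
      ∫ x in slab, pd 2 (fun x : V3 => x 2 * (G x * G x)) x := by
    refine setIntegral_mono_on ((iG.const_mul _).sub (iP.const_mul _)) iT measurableSet_slab ?_
    intro x hx
    rw [e]
    have h1 : x 2 ^ 2 ≤ 1 := by nlinarith [hx.1, hx.2]
    nlinarith [sq_nonneg (G x + 2 * x 2 * pd 2 G x), mul_nonneg (sub_nonneg.2 h1)
      (sq_nonneg (pd 2 G x))]
  rw [hI, integral_sub (iG.const_mul _) (iP.const_mul _), integral_const_mul,
    integral_const_mul] at hle
  linarith

theorem abs_le_of_pd_two_eq_rad {U : Fin 3 → V3 → ℝ} {W : V3 → ℝ} {M R : ℝ}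
    (hW : ContDiff ℝ (⊤ : ℕ∞) W) (h2 : ∀ x, pd 2 W x = rad U x) (h0 : ∀ x, x 2 = 0 → W x = 0)
    (hM : ∀ i x, |U i x| ≤ M) {x : V3} (hx : ∀ j : Fin 3, j ≠ 2 → |x j| ≤ R) (hs : x ∈ slab) :
    |W x| ≤ 2 * R * M := by
  have hd : ∀ t : ℝ, HasDerivAt (fun t : ℝ => W (x + (t - x 2) • (Pi.single 2 1 : V3)))
      (rad U (x + (t - x 2) • (Pi.single 2 1 : V3))) t := by
    intro t
    have h1 : HasDerivAt (fun t : ℝ => x + (t - x 2) • (Pi.single 2 1 : V3))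
        ((1 : ℝ) • (Pi.single 2 1 : V3)) t :=
      (((hasDerivAt_id t).sub_const (x 2)).smul_const _).const_add x
    have h := (differentiableAt_of_contDiff hW
      (x + (t - x 2) • (Pi.single 2 1 : V3))).hasFDerivAt.comp_hasDerivAt t h1
    rw [one_smul] at h
    rw [← h2]
    exact h
  have hb : ∀ t : ℝ, ‖rad U (x + (t - x 2) • (Pi.single 2 1 : V3))‖ ≤ 2 * R * M := by
    intro t
    refine abs_rad_le hM fun j hj => ?_
    have : (x + (t - x 2) • (Pi.single 2 1 : V3)) j = x j := by simp [hj]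
    rw [this]
    exact hx j hj
  have h := convex_univ.norm_image_sub_le_of_norm_hasDerivWithin_le (x := 0) (y := x 2)
    (fun t _ => (hd t).hasDerivWithinAt) (fun t _ => hb t) (Set.mem_univ _) (Set.mem_univ _)
  have e0 : W (x + (0 - x 2) • (Pi.single 2 1 : V3)) = 0 := h0 _ (by simp)
  rw [e0, sub_self, zero_smul, add_zero, sub_zero, sub_zero, Real.norm_eq_abs, Real.norm_eq_abs,
    abs_of_nonneg hs.1] at h
  have hn := (norm_nonneg _).trans (hb 0)
  exact h.trans (mul_le_of_le_one_right hn hs.2)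

theorem abs_sum_three_le {f : Fin 3 → ℝ} {c : ℝ} (h : ∀ i, |f i| ≤ c) : |∑ i, f i| ≤ 3 * c := by
  refine (Finset.abs_sum_le_sum_abs _ _).trans ((Finset.sum_le_sum fun i _ => h i).trans ?_)
  simp

theorem abs_mul_le_mul {a b A B : ℝ} (ha : |a| ≤ A) (hb : |b| ≤ B) : |a * b| ≤ A * B := by
  rw [abs_mul]
  exact mul_le_mul ha hb (abs_nonneg _) ((abs_nonneg _).trans ha)

theorem abs_add_le_add {a b A B : ℝ} (ha : |a| ≤ A) (hb : |b| ≤ B) : |a + b| ≤ A + B :=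
  (abs_add_le _ _).trans (add_le_add ha hb)

theorem abs_sub_le_add {a b A B : ℝ} (ha : |a| ≤ A) (hb : |b| ≤ B) : |a - b| ≤ A + B :=
  (abs_sub _ _).trans (add_le_add ha hb)

theorem abs_cross3_le {a c : V3} {A C : ℝ} (ha : ∀ i, |a i| ≤ A) (hc : ∀ i, |c i| ≤ C)
    (i : Fin 3) : |cross3 a c i| ≤ 2 * (A * C) := by
  rw [two_mul]
  fin_cases i <;>
    exact abs_sub_le_add (abs_mul_le_mul (ha _) (hc _)) (abs_mul_le_mul (ha _) (hc _))

theorem abs_curlc_le {B : Fin 3 → V3 → ℝ} {x : V3} {s : ℝ} (h : ∀ i j, |pd j (B i) x| ≤ s)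
    (i : Fin 3) : |curlc B x i| ≤ 2 * s := by
  rw [two_mul]
  fin_cases i <;> exact abs_sub_le_add (h _ _) (h _ _)

theorem dens_nonneg (U B : Fin 3 → V3 → ℝ) (x : V3) : 0 ≤ dens U B x :=
  Finset.sum_nonneg fun _ _ => add_nonneg (Finset.sum_nonneg fun _ _ => mul_self_nonneg _)
    (Finset.sum_nonneg fun _ _ => mul_self_nonneg _)

theorem abs_pd_le_sqrt_dens (U B : Fin 3 → V3 → ℝ) (x : V3) (i j : Fin 3) :
    |pd j (U i) x| ≤ √(dens U B x) ∧ |pd j (B i) x| ≤ √(dens U B x) := by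
  have h := Finset.single_le_sum (f := fun i => gdot (U i) (U i) x + gdot (B i) (B i) x)
    (fun _ _ => add_nonneg (Finset.sum_nonneg fun _ _ => mul_self_nonneg _)
      (Finset.sum_nonneg fun _ _ => mul_self_nonneg _)) (Finset.mem_univ i)
  have g : ∀ f : V3 → ℝ, pd j f x * pd j f x ≤ gdot f f x ∧ 0 ≤ gdot f f x := fun f =>
    ⟨Finset.single_le_sum (f := fun j => pd j f x * pd j f x) (fun j _ => mul_self_nonneg _)
      (Finset.mem_univ j), Finset.sum_nonneg fun j _ => mul_self_nonneg _⟩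
  have h' : gdot (U i) (U i) x + gdot (B i) (B i) x ≤ dens U B x := h
  constructor <;> refine Real.abs_le_sqrt ?_
  · nlinarith [g (U i), g (B i)]
  · nlinarith [g (U i), g (B i)]

theorem abs_flux_le {δ M L s : ℝ} {U B : Fin 3 → V3 → ℝ} {φ Ψ Χ : V3 → ℝ} {x : V3}
    (hδ : |δ| ≤ 1) (hU : ∀ i, |U i x| ≤ M) (hB : ∀ i, |B i x| ≤ M)
    (hdU : ∀ i j, |pd j (U i) x| ≤ s) (hdB : ∀ i j, |pd j (B i) x| ≤ s)
    (hφ : ∀ j, |pd j φ x| ≤ L) (hΨ : |Ψ x| ≤ L) (hΧ : |Χ x| ≤ L) :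
    |flux δ U B φ Ψ Χ x| ≤ (36 * M + 24 * M ^ 2) * L * s := by
  have t1 : |∑ i, (U i x * gdot (U i) φ x + B i x * gdot (B i) φ x)| ≤
      3 * (M * (3 * (s * L)) + M * (3 * (s * L))) :=
    abs_sum_three_le fun i => abs_add_le_add
      (abs_mul_le_mul (hU i) (abs_sum_three_le fun j => abs_mul_le_mul (hdU i j) (hφ j)))
      (abs_mul_le_mul (hB i) (abs_sum_three_le fun j => abs_mul_le_mul (hdB i j) (hφ j)))
  have t2 : |Ψ x * ∑ i, (U i x * pd 2 (U i) x + B i x * pd 2 (B i) x)| ≤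
      L * (3 * (M * s + M * s)) :=
    abs_mul_le_mul hΨ (abs_sum_three_le fun i => abs_add_le_add
      (abs_mul_le_mul (hU i) (hdU i 2)) (abs_mul_le_mul (hB i) (hdB i 2)))
  have t3 : |Χ x * ∑ i, (U i x * pd 2 (B i) x + B i x * pd 2 (U i) x)| ≤
      L * (3 * (M * s + M * s)) :=
    abs_mul_le_mul hΧ (abs_sum_three_le fun i => abs_add_le_add
      (abs_mul_le_mul (hU i) (hdB i 2)) (abs_mul_le_mul (hB i) (hdU i 2)))
  have t4 : |Ψ x * (adv U (U 2) x - adv B (B 2) x)| ≤ L * (3 * (M * s) + 3 * (M * s)) :=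
    abs_mul_le_mul hΨ (abs_sub_le_add
      (abs_sum_three_le fun j => abs_mul_le_mul (hU j) (hdU 2 j))
      (abs_sum_three_le fun j => abs_mul_le_mul (hB j) (hdB 2 j)))
  have t5 : |δ * ∑ i, lorentz B i x * cross3 (fun j => pd j φ x) (fun j => B j x) i| ≤
      1 * (3 * (2 * (2 * s * M) * (2 * (L * M)))) :=
    abs_mul_le_mul hδ (abs_sum_three_le fun i => abs_mul_le_mul
      (abs_cross3_le (abs_curlc_le hdB) hB i) (abs_cross3_le hφ hB i))
  have h := abs_add_le_add (abs_add_le_add (abs_add_le_add (abs_sub_le_add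
    ((abs_neg _).trans_le t1) t2) t3) t4) t5
  rw [flux]
  refine h.trans (le_of_eq ?_)
  ring

/-- The localized Dirichlet integral. -/
def energy (U B : Fin 3 → V3 → ℝ) (R : ℝ) : ℝ := ∫ x in slab, cut R x * dens U B x

theorem adm_dens {U B : Fin 3 → V3 → ℝ} (hU : ∀ i, Adm (U i)) (hB : ∀ i, Adm (B i)) :
    Adm (dens U B) :=
  Adm.sum fun i => ((hU i).gdot (hU i)).add ((hB i).gdot (hB i))

theorem abs_pd_rad_le {U : Fin 3 → V3 → ℝ} (hU : ∀ i, Adm (U i)) {M R s : ℝ} {x : V3}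
    (hM : ∀ i, |U i x| ≤ M) (hd : ∀ i j, |pd j (U i) x| ≤ s)
    (hx : ∀ j : Fin 3, j ≠ 2 → |x j| ≤ R) (j : Fin 3) :
    |pd j (rad U) x| ≤ 2 * M + 2 * R * s := by
  have hi : ∀ k : Fin 3, |(if k = j then 1 else 0 : ℝ)| ≤ 1 := fun k => by split_ifs <;> simp
  rw [pd_rad hU]
  refine (abs_add_le_add
    (abs_add_le_add (abs_mul_le_mul (hi 0) (hM 0)) (abs_mul_le_mul (hx 0 (by decide)) (hd 0 j)))
    (abs_add_le_add (abs_mul_le_mul (hi 1) (hM 1))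
      (abs_mul_le_mul (hx 1 (by decide)) (hd 1 j)))).trans (le_of_eq ?_)
  ring

/-- Multipliers `ψ W` with `∂₃ W = r uʳ`: their horizontal derivatives are controlled by the
energy on an annulus. -/
theorem integral_pd_multiplier_sq_le {U B : Fin 3 → V3 → ℝ} {W : V3 → ℝ} {K M R : ℝ}
    (hU : ∀ i, Adm (U i)) (hB : ∀ i, Adm (B i)) (hW : Adm W) (h2 : ∀ x, pd 2 W x = rad U x)
    (h0 : ∀ x, x 2 = 0 → W x = 0) (hM : ∀ i x, |U i x| ≤ M) (hR : 0 < R)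
    (hK : ∀ x, (cutD R x = 0 ∧ ∀ j, pd j (cutD R) x = 0) ∨
      (ann R x = 1 ∧ (∀ j, j ≠ 2 → |x j| ≤ 2 * R) ∧ |cutD R x| ≤ K / R ^ 2 ∧
        ∀ j, |pd j (cutD R) x| ≤ K / R ^ 3)) {j : Fin 3} (hj : j ≠ 2) :
    ∫ x in slab, pd j (fun x => cutD R x * W x) x ^ 2 ≤
      4 * (72 * K ^ 2 * M ^ 2 + 32 * K ^ 2) *
        (64 / R ^ 2 + (∫ x in slab, ann R x * dens U B x) / R ^ 2) := by
  set Ψ : V3 → ℝ := fun x => cutD R x * W x with hΨ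
  have hD := tst_cutD hR
  have tΨ : Tst Ψ := Tst.mul_right hD hW
  have hr := adm_rad hU
  have eΨ : pd 2 Ψ = fun x => cutD R x * rad U x := by
    funext x
    rw [hΨ, pd_mul hD.smooth hW.smooth, h2, pd_cutD]
    simp
  have eG : ∀ x, pd 2 (pd j Ψ) x = cutD R x * pd j (rad U) x + pd j (cutD R) x * rad U x := by
    intro x
    rw [pd_comm tΨ.smooth, eΨ, pd_mul hD.smooth hr.smooth]
  have hG0 : ∀ x, x 2 = 0 → pd j Ψ x = 0 := by
    intro x hx
    have hl : ∀ y ∈ Set.range fun t : ℝ => x + t • (Pi.single j 1 : V3), Ψ y = 0 := by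
      rintro y ⟨t, rfl⟩
      have : W (x + t • (Pi.single j 1 : V3)) = 0 := h0 _ (by simp [hx, hj.symm])
      rw [hΨ]
      simp only [this, mul_zero]
    have hd : HasDerivAt (fun t : ℝ => x + t • (Pi.single j 1 : V3))
        ((1 : ℝ) • (Pi.single j 1 : V3)) 0 :=
      ((hasDerivAt_id (0 : ℝ)).smul_const _).const_add x
    have h := (differentiableAt_of_contDiff tΨ.smooth
      (x + (0 : ℝ) • (Pi.single j 1 : V3))).hasFDerivAt.comp_hasDerivAt 0 hd
    have hc : (Ψ ∘ fun t : ℝ => x + t • (Pi.single j 1 : V3)) = fun _ => 0 :=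
      funext fun t => hl _ ⟨t, rfl⟩
    rw [hc] at h
    have := h.unique (hasDerivAt_const _ _)
    simpa [pd] using this
  have hE : Tst fun x => ann R x * dens U B x := Tst.mul_right (tst_ann hR) (adm_dens hU hB)
  have iA := (tst_ann hR).integrableOn
  set C := 72 * K ^ 2 * M ^ 2 + 32 * K ^ 2 with hC
  have hC0 : 0 ≤ C := by positivity
  have hb : ∀ x, pd 2 (pd j Ψ) x ^ 2 ≤
      C / R ^ 4 * ann R x + C / R ^ 2 * (ann R x * dens U B x) := by
    intro x
    rw [eG]
    rcases hK x with ⟨k0, k1⟩ | ⟨ka, kx, k0, k1⟩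
    · have := ann_nonneg hR x
      have := dens_nonneg U B x
      rw [k0, k1]
      simp only [zero_mul, add_zero, ne_eq, OfNat.ofNat_ne_zero, not_false_eq_true, zero_pow]
      positivity
    · rw [ka, one_mul, mul_one]
      obtain ⟨s, hs, hss⟩ : ∃ s, √(dens U B x) = s ∧ dens U B x = s ^ 2 :=
        ⟨_, rfl, (Real.sq_sqrt (dens_nonneg U B x)).symm⟩
      have a1 := abs_mul_le_mul k0 (abs_pd_rad_le hU (fun i => hM i x)
        (fun i j => (abs_pd_le_sqrt_dens U B x i j).1) kx j)
      have a2 := abs_mul_le_mul (k1 j) (abs_rad_le hM kx)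
      have a := sq_le_sq' (abs_le.1 (abs_add_le_add a1 a2)).1 (abs_le.1 (abs_add_le_add a1 a2)).2
      refine a.trans ?_
      rw [hs, hss]
      have e1 : K / R ^ 2 * (2 * M + 2 * (2 * R) * s) + K / R ^ 3 * (2 * (2 * R) * M) =
          6 * K * M / R ^ 2 + 4 * K * s / R := by
        field_simp; ring
      have e2 : C / R ^ 4 + C / R ^ 2 * s ^ 2 = 2 * (6 * K * M / R ^ 2) ^ 2 +
          2 * (4 * K * s / R) ^ 2 + 32 * K ^ 2 / R ^ 4 + 72 * K ^ 2 * M ^ 2 / R ^ 2 * s ^ 2 := by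
        rw [hC]; field_simp; ring
      rw [e1, e2]
      have p1 : 0 ≤ 32 * K ^ 2 / R ^ 4 := by positivity
      have p2 : 0 ≤ 72 * K ^ 2 * M ^ 2 / R ^ 2 * s ^ 2 := by positivity
      nlinarith [sq_nonneg (6 * K * M / R ^ 2 - 4 * K * s / R)]
  have tG := (tΨ.pd j).pd 2
  have iP : IntegrableOn (fun x => pd 2 (pd j Ψ) x ^ 2) slab := by
    simpa only [pow_two] using (Tst.mul_left tG.toAdm tG).integrableOn
  have hI := integral_mono iP
    ((iA.const_mul (C / R ^ 4)).add (hE.integrableOn.const_mul (C / R ^ 2))) hb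
  rw [integral_add' (iA.const_mul _) (hE.integrableOn.const_mul _), integral_const_mul,
    integral_const_mul] at hI
  have hA := integral_ann_le hR
  have hA' : C / R ^ 4 * ∫ x in slab, ann R x ≤ C * (64 / R ^ 2) :=
    (mul_le_mul_of_nonneg_left hA (by positivity)).trans (le_of_eq (by field_simp))
  calc _ ≤ 4 * ∫ x in slab, pd 2 (pd j Ψ) x ^ 2 := integral_sq_le_integral_pd_sq (tΨ.pd j) hG0
    _ ≤ 4 * (C * (64 / R ^ 2) + C / R ^ 2 * ∫ x in slab, ann R x * dens U B x) := by linarith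
    _ = _ := by ring

theorem mul_le_add_sq_scaled {a b r : ℝ} (hr : 0 < r) : a * b ≤ a ^ 2 / r + r * b ^ 2 := by
  have h : a ^ 2 / r + r * b ^ 2 - a * b = ((a - r * b) ^ 2 + a * (r * b)) / r := by
    field_simp; ring
  have h' : 0 ≤ (a - r * b) ^ 2 + a * (r * b) := by
    nlinarith [sq_nonneg (a - r * b), sq_nonneg (a + r * b)]
  have := div_nonneg h' hr.le
  linarith

theorem Flow.energy_le {δ M : ℝ} {U B : Fin 3 → V3 → ℝ} {p W Z : V3 → ℝ} (h : Flow δ U B p)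
    (hδ : |δ| ≤ 1) (hMU : ∀ i x, |U i x| ≤ M) (hMB : ∀ i x, |B i x| ≤ M)
    (hW : Adm W) (hW2 : ∀ x, pd 2 W x = rad U x) (hW0 : ∀ x, x 2 = 0 → W x = 0)
    (hZ : Adm Z) (hZ2 : ∀ x, pd 2 Z x = rad B x) (hZ0 : ∀ x, x 2 = 0 → Z x = 0) :
    ∃ K : ℝ, 0 < K ∧ ∀ R : ℝ, 1 ≤ R → ∀ ε : ℝ, 0 < ε → energy U B R ≤
      K * ((1 / ε + 1 / R) * (energy U B (2 * R) - energy U B (R / 2)) + ε + 1 / R) := by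
  obtain ⟨K, hK1, hK⟩ := exists_cut_bound
  have hM : 0 ≤ M := (abs_nonneg _).trans (hMU 0 0)
  have hK0 : 0 ≤ K := by linarith
  set C₁ := ((36 * M + 24 * M ^ 2) * (4 * K * M + 2 * K) + 4 * K * M) with hC₁
  set C₂ := 4 * (72 * K ^ 2 * M ^ 2 + 32 * K ^ 2) with hC₂
  have hC₁0 : 0 ≤ C₁ := by positivity
  have hC₂0 : 0 ≤ C₂ := by positivity
  refine ⟨64 * C₁ + 2 + 128 * C₂, by positivity, fun R hR1 ε hε => ?_⟩
  have hR : 0 < R := by linarith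
  have tφ := tst_cut hR
  have tD := tst_cutD hR
  have tA := tst_ann hR
  have hd := adm_dens h.admU h.admB
  have hd0 := dens_nonneg U B
  set Ψ : V3 → ℝ := fun x => cutD R x * W x with hΨ
  set Χ : V3 → ℝ := fun x => cutD R x * Z x with hΧ
  have tΨ : Tst Ψ := Tst.mul_right tD hW
  have tΧ : Tst Χ := Tst.mul_right tD hZ
  have ePΨ : ∀ j x, pd j Ψ x = cutD R x * pd j W x + pd j (cutD R) x * W x := fun j x =>
    pd_mul tD.smooth hW.smooth j x
  have eΨ2 : ∀ x, pd 2 Ψ x = cutD R x * rad U x := by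
    intro x
    rw [ePΨ, hW2, pd_cutD]
    simp
  have eΧ2 : ∀ x, pd 2 Χ x = cutD R x * rad B x := by
    intro x
    rw [hΧ, pd_mul tD.smooth hZ.smooth, hZ2, pd_cutD]
    simp
  have hN := h.null_energy tφ tΨ tΧ (fun x => by rw [eΨ2, adv_cut])
    (fun x => by rw [eΧ2, adv_cut])
  set F : V3 → ℝ := fun x => flux δ U B (cut R) Ψ Χ x + gdot (U 2) Ψ x with hF
  have iφ : IntegrableOn (fun x => cut R x * dens U B x) slab :=
    (Tst.mul_right tφ hd).integrableOn
  have iF : IntegrableOn F slab :=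
    (iφ.sub hN.1).congr_fun (fun x _ => by simp only [hF, Pi.sub_apply]; ring) measurableSet_slab
  have hE : energy U B R = ∫ x in slab, F x := by
    have h1 : ∫ x in slab, (cut R x * dens U B x - F x) = 0 := by
      rw [← hN.2]
      refine integral_congr_ae (Filter.Eventually.of_forall fun x => ?_)
      simp only [hF]
      ring
    rw [integral_sub iφ iF] at h1
    rw [energy]
    linarith
  set D := energy U B (2 * R) - energy U B (R / 2) with hDdef
  have iE : IntegrableOn (fun x => ann R x * dens U B x) slab :=
    (Tst.mul_right tA hd).integrableOn
  have hD : ∫ x in slab, ann R x * dens U B x = D := by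
    rw [hDdef, energy, energy, ← integral_sub]
    · simp only [ann, sub_mul]
    · exact (Tst.mul_right (tst_cut (by linarith)) hd).integrableOn
    · exact (Tst.mul_right (tst_cut (by linarith)) hd).integrableOn
  have hD0 : 0 ≤ D := by
    rw [← hD]
    exact integral_nonneg fun x => mul_nonneg (ann_nonneg hR x) (hd0 x)
  set H : V3 → ℝ := fun x => (C₁ * (ε / R ^ 2)) * ann R x +
    (C₁ / ε + 2 / R) * (ann R x * dens U B x) + (R * pd 0 Ψ x ^ 2 + R * pd 1 Ψ x ^ 2) with hH
  have iP : ∀ j, IntegrableOn (fun x => R * pd j Ψ x ^ 2) slab := by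
    intro j
    simp only [pow_two]
    exact (Tst.mul_left (tΨ.pd j).toAdm (tΨ.pd j)).integrableOn.const_mul R
  have i1 := tA.integrableOn.const_mul (C₁ * (ε / R ^ 2))
  have i2 := iE.const_mul (C₁ / ε + 2 / R)
  have i12 : IntegrableOn (fun x => (C₁ * (ε / R ^ 2)) * ann R x +
    (C₁ / ε + 2 / R) * (ann R x * dens U B x)) slab := i1.add i2
  have i34 : IntegrableOn (fun x => R * pd 0 Ψ x ^ 2 + R * pd 1 Ψ x ^ 2) slab :=
    (iP 0).add (iP 1)
  have hFH : ∀ x ∈ slab, F x ≤ H x := by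
    intro x hx
    refine (le_abs_self _).trans ?_
    have hq0 := mul_nonneg hR.le (sq_nonneg (pd 0 Ψ x))
    have hq1 := mul_nonneg hR.le (sq_nonneg (pd 1 Ψ x))
    have hs := fun i j => abs_pd_le_sqrt_dens U B x i j
    obtain ⟨s, hs', hss⟩ : ∃ s, √(dens U B x) = s ∧ dens U B x = s ^ 2 :=
      ⟨_, rfl, (Real.sq_sqrt (hd0 x)).symm⟩
    rw [hs'] at hs
    have hs0 : 0 ≤ s := (abs_nonneg _).trans (hs 0 0).1
    rcases hK R hR x with ⟨k0, k1⟩ | ⟨ka, kx, k0, k1⟩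
    · have hfl := abs_flux_le (δ := δ) (L := 0) (x := x) (φ := cut R) (Ψ := Ψ) (Χ := Χ) hδ
        (fun i => hMU i x) (fun i => hMB i x) (fun i j => (hs i j).1) (fun i j => (hs i j).2)
        (fun j => by rw [pd_cut, k0]; simp) (by simp [hΨ, k0]) (by simp [hΧ, k0])
      have hg : gdot (U 2) Ψ x = 0 :=
        Finset.sum_eq_zero fun j _ => by rw [ePΨ, k0, k1]; ring
      have h1 : 0 ≤ (C₁ * (ε / R ^ 2)) * ann R x := mul_nonneg (by positivity) (ann_nonneg hR x)
      have h2 : 0 ≤ (C₁ / ε + 2 / R) * (ann R x * dens U B x) :=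
        mul_nonneg (by positivity) (mul_nonneg (ann_nonneg hR x) (hd0 x))
      simp only [hF, hH, hg, add_zero]
      linarith
    · have hWx := abs_le_of_pd_two_eq_rad hW.smooth hW2 hW0 hMU kx hx
      have hZx := abs_le_of_pd_two_eq_rad hZ.smooth hZ2 hZ0 hMB kx hx
      set L := (4 * K * M + 2 * K) / R with hL
      have hKM : 0 ≤ K * M / R := by positivity
      have hKR : 0 ≤ K / R := by positivity
      have eL : L = 4 * (K * M / R) + 2 * (K / R) := by rw [hL]; ring
      have m1 : K / R ^ 2 * (2 * (2 * R) * M) = 4 * (K * M / R) := by field_simp; ring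
      have m2 : K / R ^ 2 * (2 * R) = 2 * (K / R) := by field_simp
      have hφL : ∀ j, |pd j (cut R) x| ≤ L := by
        intro j
        rw [pd_cut]
        split_ifs with hj
        · rw [mul_zero, abs_zero]
          linarith
        · have := abs_mul_le_mul k0 (kx j hj)
          linarith
      have hΨL : |Ψ x| ≤ L := by
        have := abs_mul_le_mul k0 hWx
        have : |Ψ x| ≤ K / R ^ 2 * (2 * (2 * R) * M) := this
        linarith
      have hΧL : |Χ x| ≤ L := by
        have := abs_mul_le_mul k0 hZx
        have : |Χ x| ≤ K / R ^ 2 * (2 * (2 * R) * M) := this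
        linarith
      have hfl := abs_flux_le (δ := δ) hδ (fun i => hMU i x) (fun i => hMB i x)
        (fun i j => (hs i j).1) (fun i j => (hs i j).2) hφL hΨL hΧL
      have hg2 : |pd 2 (U 2) x * pd 2 Ψ x| ≤ s * (4 * (K * M / R)) := by
        rw [eΨ2, ← m1]
        exact abs_mul_le_mul (hs 2 2).1 (abs_mul_le_mul k0 (abs_rad_le hMU kx))
      have hgj : ∀ j, |pd j (U 2) x * pd j Ψ x| ≤ s ^ 2 / R + R * pd j Ψ x ^ 2 := by
        intro j
        have h1 := mul_le_add_sq_scaled (a := s) (b := |pd j Ψ x|) hR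
        rw [sq_abs] at h1
        exact (abs_mul_le_mul (hs 2 j).1 le_rfl).trans h1
      have hyo : s * (1 / R) ≤ s ^ 2 / ε + ε * (1 / R) ^ 2 := mul_le_add_sq_scaled hε
      have hyo' := mul_le_mul_of_nonneg_left hyo hC₁0
      have e1 : (36 * M + 24 * M ^ 2) * L * s + s * (4 * (K * M / R)) = C₁ * (s * (1 / R)) := by
        rw [hL, hC₁]; ring
      have e2 : C₁ * (s ^ 2 / ε + ε * (1 / R) ^ 2) + 2 * (s ^ 2 / R) =
          C₁ * (ε / R ^ 2) * 1 + (C₁ / ε + 2 / R) * (1 * s ^ 2) := by ring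
      have hsum : |F x| ≤ |flux δ U B (cut R) Ψ Χ x| + (|pd 0 (U 2) x * pd 0 Ψ x| +
          |pd 1 (U 2) x * pd 1 Ψ x| + |pd 2 (U 2) x * pd 2 Ψ x|) := by
        simp only [hF, gdot, Fin.sum_univ_three]
        exact abs_add_le_add le_rfl (abs_add_three _ _ _)
      simp only [hH, ka, hss]
      linarith [hgj 0, hgj 1]
  have hI := setIntegral_mono_on iF (i12.add i34) measurableSet_slab hFH
  have hKR := hK R hR
  have hP : ∀ j : Fin 3, j ≠ 2 → ∫ x in slab, R * pd j Ψ x ^ 2 ≤ C₂ * (64 / R + D / R) := by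
    intro j hj
    have := integral_pd_multiplier_sq_le h.admU h.admB hW hW2 hW0 hMU hR hKR hj
    rw [hD] at this
    rw [integral_const_mul]
    refine (mul_le_mul_of_nonneg_left this hR.le).trans (le_of_eq ?_)
    rw [← hC₂]
    field_simp
  have hA : C₁ * (ε / R ^ 2) * ∫ x in slab, ann R x ≤ 64 * C₁ * ε := by
    refine (mul_le_mul_of_nonneg_left (integral_ann_le hR) (by positivity)).trans (le_of_eq ?_)
    field_simp
  rw [integral_add' i12 i34, integral_add i1 i2, integral_add (iP 0) (iP 1), integral_const_mul,
    integral_const_mul, hD, ← hE] at hI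
  have h0 := hP 0 (by decide)
  have h1 := hP 1 (by decide)
  have q1 : 0 ≤ D / R := by positivity
  have q2 : 0 ≤ D / ε := by positivity
  have q3 : 0 ≤ 1 / R := by positivity
  have e3 : (C₁ / ε + 2 / R) * D = C₁ * (D / ε) + 2 * (D / R) := by ring
  have e4 : (64 * C₁ + 2 + 128 * C₂) * ((1 / ε + 1 / R) * D + ε + 1 / R) =
      (64 * C₁ + 2 + 128 * C₂) * (D / ε + D / R + ε + 1 / R) := by ring
  have e5 : C₂ * (64 / R + D / R) = 64 * (C₂ * (1 / R)) + C₂ * (D / R) := by ring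
  rw [e4]
  rw [e3] at hI
  rw [e5] at h0 h1
  nlinarith [mul_nonneg hC₁0 q1, mul_nonneg hC₁0 q2, mul_nonneg hC₁0 q3, mul_nonneg hC₁0 hε.le,
    mul_nonneg hC₂0 q1, mul_nonneg hC₂0 q2, mul_nonneg hC₂0 q3, mul_nonneg hC₂0 hε.le]

/-! ### Iteration -/

theorem eq_zero_of_iteration {a ρ : ℕ → ℝ} {K C q : ℝ} (ha : Monotone a) (h0 : ∀ k, 0 ≤ a k)
    (hK : 0 < K) (hq : 0 < q) (hρ : Filter.Tendsto ρ Filter.atTop (nhds 0))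
    (hstep : ∀ k, ∀ ε : ℝ, 0 < ε → a k ≤ K * ((1 / ε + ρ k) * (a (k + 1) - a k) + ε + ρ k))
    (hgrow : ∀ k, a k ≤ C * q ^ k) (k : ℕ) : a k = 0 := by
  by_contra hk
  have hA : 0 < a k := lt_of_le_of_ne (h0 k) (Ne.symm hk)
  set A := a k with hAdef
  have hρ' : ∀ c : ℝ, 0 < c → ∃ N, ∀ n ≥ N, ρ n ≤ c := fun c hc =>
    Filter.eventually_atTop.1 (hρ.eventually_le_const hc)
  have hΔ : ∀ n, 0 ≤ a (n + 1) - a n := fun n => sub_nonneg.2 (ha n.le_succ)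
  obtain ⟨η, hη, N₁, hN₁⟩ : ∃ η > 0, ∃ N, ∀ n ≥ N, η ≤ a (n + 1) - a n := by
    obtain ⟨N, hN⟩ := hρ' (A / (4 * K)) (by positivity)
    set P := K * (4 * K / A + A / (4 * K)) with hP
    have hP0 : 0 < P := by positivity
    refine ⟨A / (2 * P), by positivity, max N k, fun n hn => ?_⟩
    have h1 := hstep n (A / (4 * K)) (by positivity)
    have h2 := hN n ((le_max_left _ _).trans hn)
    have h3 : A ≤ a n := ha ((le_max_right _ _).trans hn)
    have h4 : (1 / (A / (4 * K)) + ρ n) * (a (n + 1) - a n) ≤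
        (4 * K / A + A / (4 * K)) * (a (n + 1) - a n) := by
      refine mul_le_mul_of_nonneg_right ?_ (hΔ n)
      rw [one_div_div]
      linarith
    have h5 : A ≤ P * (a (n + 1) - a n) + A / 2 := by
      calc A ≤ K * ((4 * K / A + A / (4 * K)) * (a (n + 1) - a n) + A / (4 * K) + A / (4 * K)) :=
            h3.trans (h1.trans (by gcongr))
        _ = _ := by rw [hP]; field_simp; ring
    rw [div_le_iff₀ (by positivity)]
    linarith
  have hlin : ∀ n : ℕ, n * η ≤ a (N₁ + n) := by
    intro n
    induction n with
    | zero => simpa using h0 N₁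
    | succ n ih =>
      have := hN₁ (N₁ + n) (by omega)
      push_cast
      rw [← add_assoc]
      linarith
  set E := 8 * K * q with hE
  have hE0 : 0 < E := by positivity
  obtain ⟨N₂, hN₂⟩ := hρ' (min 1 (1 / E)) (by positivity)
  obtain ⟨m, hm⟩ := exists_nat_gt (2 * K * (E + 1) / η)
  rw [div_lt_iff₀ hη] at hm
  set N := max (N₁ + m) N₂ with hN
  have hbig : ∀ n ≥ N, 2 * K * (E + 1) ≤ a n := fun n hn =>
    hm.le.trans ((hlin m).trans (ha ((le_max_left _ _).trans hn)))
  have hgeo : ∀ n ≥ N, 2 * q * a n ≤ a (n + 1) := by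
    intro n hn
    have h1 := hstep n E hE0
    have h2 := hN₂ n ((le_max_right _ _).trans hn)
    have h3 : ρ n ≤ 1 := h2.trans (min_le_left _ _)
    have h4 : ρ n ≤ 1 / E := h2.trans (min_le_right _ _)
    have h5 : (1 / E + ρ n) * (a (n + 1) - a n) ≤ (2 / E) * (a (n + 1) - a n) := by
      refine mul_le_mul_of_nonneg_right ?_ (hΔ n)
      linarith [show 2 / E = 1 / E + 1 / E by ring]
    have h6 : a n ≤ K * ((2 / E) * (a (n + 1) - a n)) + K * (E + 1) := by
      calc a n ≤ K * ((2 / E) * (a (n + 1) - a n) + E + 1) := h1.trans (by gcongr)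
        _ = _ := by ring
    have h7 : K * ((2 / E) * (a (n + 1) - a n)) = (a (n + 1) - a n) / (4 * q) := by
      rw [hE]; field_simp; ring
    rw [h7] at h6
    have h8 : a n / 2 ≤ (a (n + 1) - a n) / (4 * q) := by linarith [hbig n hn]
    rw [le_div_iff₀ (by positivity)] at h8
    linarith [h0 n]
  have hpow : ∀ n : ℕ, (2 * q) ^ n * a N ≤ a (N + n) := by
    intro n
    induction n with
    | zero => simp
    | succ n ih =>
      have := hgeo (N + n) (by omega)
      calc (2 * q) ^ (n + 1) * a N = 2 * q * ((2 * q) ^ n * a N) := by ring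
        _ ≤ 2 * q * a (N + n) := by gcongr
        _ ≤ _ := this
  have haN : 0 < a N := lt_of_lt_of_le (by positivity) (hbig N le_rfl)
  obtain ⟨n, hn⟩ := pow_unbounded_of_one_lt (C * q ^ N / a N) (one_lt_two (α := ℝ))
  rw [div_lt_iff₀ haN] at hn
  have h1 := (hpow n).trans (hgrow (N + n))
  rw [mul_pow, pow_add] at h1
  have h2 : q ^ n * (2 ^ n * a N) ≤ q ^ n * (C * q ^ N) := by linarith
  exact absurd (le_of_mul_le_mul_left h2 (by positivity)) (not_le.2 hn)

theorem energy_mono {U B : Fin 3 → V3 → ℝ} (hU : ∀ i, Adm (U i)) (hB : ∀ i, Adm (B i)) {R S : ℝ}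
    (hR : 0 < R) (hRS : R ≤ S) : energy U B R ≤ energy U B S :=
  integral_mono (Tst.mul_right (tst_cut hR) (adm_dens hU hB)).integrableOn
    (Tst.mul_right (tst_cut (hR.trans_le hRS)) (adm_dens hU hB)).integrableOn
    fun x => mul_le_mul_of_nonneg_right (cut_mono hR hRS x) (dens_nonneg U B x)

theorem energy_nonneg (U B : Fin 3 → V3 → ℝ) (R : ℝ) : 0 ≤ energy U B R :=
  integral_nonneg fun x => mul_nonneg (cut_nonneg R x) (dens_nonneg U B x)

theorem energy_eq_zero {U B : Fin 3 → V3 → ℝ} {K C α : ℝ}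
    (hU : ∀ i, Adm (U i)) (hB : ∀ i, Adm (B i)) (hK : 0 < K)
    (hE : ∀ R : ℝ, 1 ≤ R → ∀ ε : ℝ, 0 < ε → energy U B R ≤
      K * ((1 / ε + 1 / R) * (energy U B (2 * R) - energy U B (R / 2)) + ε + 1 / R))
    (hG : ∀ R : ℝ, 1 ≤ R → energy U B R ≤ C * R ^ α) (k : ℕ) : energy U B (4 ^ k) = 0 := by
  have hp : ∀ k : ℕ, (1 : ℝ) ≤ 4 ^ k := fun k => one_le_pow₀ (by norm_num)
  have hr : Filter.Tendsto (fun k : ℕ => 1 / (2 * (4 : ℝ) ^ k)) Filter.atTop (nhds 0) := by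
    have := (tendsto_pow_atTop_nhds_zero_of_lt_one (r := (1 / 4 : ℝ)) (by norm_num)
      (by norm_num)).const_mul (1 / 2)
    rw [mul_zero] at this
    refine this.congr fun k => ?_
    rw [one_div_pow]
    field_simp
  refine eq_zero_of_iteration (a := fun k => energy U B (4 ^ k))
    (ρ := fun k => 1 / (2 * (4 : ℝ) ^ k)) (q := 4 ^ α) (C := C)
    (monotone_nat_of_le_succ fun k => ?_) (fun k => energy_nonneg _ _ _) hK (by positivity) hr
    (fun k ε hε => ?_) (fun k => ?_) k
  · refine energy_mono hU hB (by positivity) ?_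
    rw [pow_succ]
    linarith [hp k]
  · have h1 := hE (2 * 4 ^ k) (by linarith [hp k]) ε hε
    have e1 : (2 : ℝ) * (2 * 4 ^ k) = 4 ^ (k + 1) := by ring
    have e2 : (2 : ℝ) * 4 ^ k / 2 = 4 ^ k := by ring
    rw [e1, e2] at h1
    exact (energy_mono hU hB (by positivity) (by linarith [hp k])).trans h1
  · rw [Real.rpow_pow_comm (by norm_num)]
    exact hG (4 ^ k) (hp k)

/-! ### Conclusion -/

theorem dens_eq_zero {U B : Fin 3 → V3 → ℝ} (hU : ∀ i, Adm (U i)) (hB : ∀ i, Adm (B i))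
    (h : ∀ k : ℕ, energy U B (4 ^ k) = 0) (x : V3) : dens U B x = 0 := by
  have hd := adm_dens hU hB
  have hcl : slab ⊆ closure (interior slab) := by
    have hconv : Convex ℝ slab :=
      (convex_Icc (0 : ℝ) 1).linear_preimage (LinearMap.proj 2 : V3 →ₗ[ℝ] ℝ)
    have hne : (interior slab).Nonempty := by
      have hI : Set.Icc (0 : ℝ) 1 ∈ nhds ((fun _ => 1 / 2 : V3) 2) :=
        Icc_mem_nhds (by norm_num) (by norm_num)
      have hm : (fun p : V3 => p 2) ⁻¹' Set.Icc (0 : ℝ) 1 ∈ nhds (fun _ => 1 / 2 : V3) :=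
        (show Continuous fun p : V3 => p 2 by fun_prop).continuousAt.preimage_mem_nhds hI
      exact ⟨fun _ => 1 / 2, mem_interior_iff_mem_nhds.2 hm⟩
    rw [hconv.closure_interior_eq_closure_of_nonempty_interior hne]
    exact subset_closure
  have hslab : ∀ y ∈ slab, dens U B y = 0 := by
    intro y hy
    obtain ⟨k, hk⟩ := pow_unbounded_of_one_lt (y 0 ^ 2 + y 1 ^ 2) (show (1 : ℝ) < 4 by norm_num)
    have hR : (0 : ℝ) < 4 ^ k := by positivity
    have t : Tst fun x => cut (4 ^ k) x * dens U B x := Tst.mul_right (tst_cut hR) hd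
    have hae := (integral_eq_zero_iff_of_nonneg
      (fun x => mul_nonneg (cut_nonneg _ x) (dens_nonneg U B x)) t.integrableOn).1 (h k)
    have := Measure.eqOn_of_ae_eq hae t.smooth.continuous.continuousOn continuousOn_const hcl hy
    have h1 : cut (4 ^ k) y = 1 := by
      refine cut_eq_one hR (hk.le.trans ?_)
      nlinarith [one_le_pow₀ (n := k) (show (1 : ℝ) ≤ 4 by norm_num)]
    simpa [h1] using this
  have hper : Function.Periodic (dens U B) (Pi.single 2 1) := hd.per
  rw [← hper.sub_zsmul_eq ⌊x 2⌋]
  refine hslab _ ⟨?_, ?_⟩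
  · simp
  · simpa using (Int.fract_lt_one (x 2)).le

theorem cylSet_subset_box {R : ℝ} : cylSet R ⊆ box R := by
  intro x hx
  have h0 : |x 0| ≤ R := (Real.abs_le_sqrt (by nlinarith [sq_nonneg (x 1)])).trans hx.2
  have h1 : |x 1| ≤ R := (Real.abs_le_sqrt (by nlinarith [sq_nonneg (x 0)])).trans hx.2
  exact mem_box.2 ⟨⟨h0, h1⟩, hx.1⟩

theorem measurableSet_cylSet (R : ℝ) : MeasurableSet (cylSet R) := by
  have h : Continuous nr := by
    have : Continuous fun x : V3 => √(x 0 ^ 2 + x 1 ^ 2) := by fun_prop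
    exact this
  exact measurableSet_slab.inter (measurableSet_le h.measurable measurable_const)

theorem energy_le_integral_cylSet {U B : Fin 3 → V3 → ℝ} (hU : ∀ i, Adm (U i))
    (hB : ∀ i, Adm (B i)) {R : ℝ} (hR : 0 < R) :
    energy U B R ≤ ∫ x in cylSet (2 * R), dens U B x := by
  have hd := adm_dens hU hB
  have t : Tst fun x => cut R x * dens U B x := Tst.mul_right (tst_cut hR) hd
  have hsub : cylSet (2 * R) ⊆ slab := fun x hx => hx.1
  have e : energy U B R = ∫ x in cylSet (2 * R), cut R x * dens U B x := by
    refine setIntegral_eq_of_subset_of_forall_sdiff_eq_zero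
      (f := fun x => cut R x * dens U B x) measurableSet_slab hsub fun x hx => ?_
    have hn : 2 * R < nr x := by
      by_contra hn
      exact hx.2 ⟨hx.1, not_lt.1 hn⟩
    have hz : cut R x = 0 := cut_eq_zero hR ((Real.lt_sqrt (by positivity)).1 hn).le
    simp only [hz, zero_mul]
  rw [e]
  refine setIntegral_mono_on (t.integrableOn.mono_set hsub) ?_ (measurableSet_cylSet _)
    fun x _ => mul_le_of_le_one_left (dens_nonneg U B x) (cut_le_one R x)
  exact (hd.smooth.continuous.continuousOn.integrableOn_compact (isCompact_box _)).mono_set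
    cylSet_subset_box

theorem adm_comp {u : V3 → V3} (hu : ContDiff ℝ (⊤ : ℕ∞) u) (hp : PeriodicZ u) (i : Fin 3) :
    Adm fun x => u x i := by
  refine ⟨contDiff_pi.1 hu i, fun x => ?_⟩
  have e : x + Pi.single 2 1 = ![x 0, x 1, x 2 + 1] := by
    funext j
    fin_cases j <;> simp
  rw [e, hp x]

theorem exists_const_of_pd_eq_zero {u : V3 → V3} (hu : ContDiff ℝ (⊤ : ℕ∞) u)
    (h : ∀ i j x, pd j (fun y => u y i) x = 0) (hax : AxiSym (compTheta u)) :
    ∃ c : ℝ, ∀ x, u x = ![0, 0, c] := by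
  have hc : ∀ i x, u x i = u 0 i := by
    intro i x
    have hi := contDiff_pi.1 hu i
    refine is_const_of_fderiv_eq_zero (𝕜 := ℝ) (f := fun y => u y i)
      (hi.differentiable (by simp)) (fun y => ?_) x 0
    ext v
    rw [fderiv_apply_eq_sum]
    exact Finset.sum_eq_zero fun j _ => by rw [h, mul_zero]
  have h1 := hax 1 0 Real.pi 0
  have h2 := hax 1 (Real.pi / 2) (-(Real.pi / 2)) 0
  simp only [compTheta, hc] at h1 h2
  simp at h1 h2
  refine ⟨u 0 2, fun x => ?_⟩
  funext i
  rw [hc]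
  fin_cases i <;> simp <;> linarith

end SlabLiouville

open SlabLiouville

/-- Liouville theorem for MHD/Hall–MHD in the slab under axisymmetry
of the swirl components `u^θ, b^θ`. -/
theorem liouville_swirl_axisym (δ : ℝ) (hδ : δ ∈ Set.Icc (0:ℝ) 1)
    (u b : V3 → V3) (p : V3 → ℝ)
    (hu : ContDiff ℝ (⊤ : ℕ∞) u) (hb : ContDiff ℝ (⊤ : ℕ∞) b) (hp : ContDiff ℝ (⊤ : ℕ∞) p)
    (hubd : Bounded3 u) (hbbd : Bounded3 b)
    (hup : PeriodicZ u) (hbp : PeriodicZ b)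
    (hsol : IsMHD δ u b p)
    (hgrow : DirichletGrowth u b)
    (haxu : AxiSym (compTheta u)) (haxb : AxiSym (compTheta b)) :
    ∃ c₁ c₂ : ℝ, (∀ x, u x = ![0, 0, c₁]) ∧ (∀ x, b x = ![0, 0, c₂]) := by
  obtain ⟨M₁, hM₁⟩ := hubd
  obtain ⟨M₂, hM₂⟩ := hbbd
  obtain ⟨C, -, α, -, hC⟩ := hgrow
  obtain ⟨hmom, hind, hdu, hdb⟩ := hsol
  set U : Fin 3 → V3 → ℝ := fun i y => u y i with hUdef
  set B : Fin 3 → V3 → ℝ := fun i y => b y i with hBdef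
  have hU : ∀ i, Adm (U i) := adm_comp hu hup
  have hB : ∀ i, Adm (B i) := adm_comp hb hbp
  have hMU : ∀ i x, |U i x| ≤ max M₁ M₂ := fun i x =>
    (norm_le_pi_norm (u x) i).trans ((hM₁ x).trans (le_max_left _ _))
  have hMB : ∀ i x, |B i x| ≤ max M₁ M₂ := fun i x =>
    (norm_le_pi_norm (b x) i).trans ((hM₂ x).trans (le_max_right _ _))
  have hflow : Flow δ U B p :=
    exists_periodic_pressure hU hB hp hdu hdb hmom hind hMU hMB
  obtain ⟨W, hW, hW2, hW0⟩ := exists_stream hU hdu (swirl_invariant hu haxu)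
  obtain ⟨Z, hZ, hZ2, hZ0⟩ := exists_stream hB hdb (swirl_invariant hb haxb)
  have hδ' : |δ| ≤ 1 := abs_le.2 ⟨by linarith [hδ.1], hδ.2⟩
  obtain ⟨K, hK, hE⟩ := hflow.energy_le hδ' hMU hMB hW hW2 hW0 hZ hZ2 hZ0
  have hG : ∀ R : ℝ, 1 ≤ R → energy U B R ≤ C * 2 ^ α * R ^ α := by
    intro R hR
    refine (energy_le_integral_cylSet hU hB (by linarith)).trans ?_
    rw [mul_assoc, ← Real.mul_rpow (by norm_num) (by linarith)]
    refine le_of_eq_of_le ?_ (hC (2 * R) (by linarith))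
    congr 1
    funext x
    simp only [dens, gdot, gradSq, Fin.sum_univ_three, hUdef, hBdef]
    ring
  have hz := dens_eq_zero hU hB (energy_eq_zero hU hB hK hE hG)
  have hpd := fun i j x => abs_pd_le_sqrt_dens U B x i j
  simp only [hz, Real.sqrt_zero, abs_nonpos_iff] at hpd
  obtain ⟨c₁, h₁⟩ := exists_const_of_pd_eq_zero hu (fun i j x => (hpd i j x).1) haxu
  obtain ⟨c₂, h₂⟩ := exists_const_of_pd_eq_zero hb (fun i j x => (hpd i j x).2) haxb
  exact ⟨c₁, c₂, h₁, h₂⟩
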